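/- arXiv:2308.08280 — 3 statements merged into one kernel-verified Lean document; each statement's English description precedes it below -/
import Mathlib

section
/- Frequency-wise exponential decay for the Fourier-mode ODE: Assume (A,B) satisfies the Kalman rank condition. Then there exist constants C ≥ 1 and c > 0 such that for every ξ ∈ ℝ, every t ≥ 0 and every differentiable function V : [0,∞) → ℂⁿ satisfying V′(t) = −(iξA + B)V(t) (with A, B acting on ℂⁿ by complexification), one has |V(t)| ≤ C e^{−c·min(1,ξ²)·t} |V(0)|; equivalently, the operator norm of the matrix exponential exp(−t(iξA+B)) on ℂⁿ is at most C e^{−c·min(1,ξ²)·t}. -/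
open MeasureTheory Matrix Finset

noncomputable section

/-- Index type for the block decomposition `ℝⁿ = ℝ^{n₁} × ℝ^{n₂}`. -/
abbrev Idx (n₁ n₂ : ℕ) := Fin n₁ ⊕ Fin n₂

/-- The partially dissipative matrix `B = [[0,0],[0,D]]`. -/
def Bmat {n₁ n₂ : ℕ} (D : Matrix (Fin n₂) (Fin n₂) ℝ) :
    Matrix (Idx n₁ n₂) (Idx n₁ n₂) ℝ :=
  Matrix.fromBlocks 0 0 0 D

/-- The Kalman rank condition for the pair `(A,B)`: the only `y ∈ ℝⁿ` with
`B A^k y = 0` for all `k = 0,…,n−1` is `y = 0`. -/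
def KalmanCondition {n₁ n₂ : ℕ} (A B : Matrix (Idx n₁ n₂) (Idx n₁ n₂) ℝ) : Prop :=
  ∀ y : Idx n₁ n₂ → ℝ, (∀ k < n₁ + n₂, (B * A ^ k).mulVec y = 0) → y = 0

/-- Complexification of the Fourier-mode matrix `iξA + B`. -/
def fourierModeMatrix {n₁ n₂ : ℕ} (A : Matrix (Idx n₁ n₂) (Idx n₁ n₂) ℝ)
    (D : Matrix (Fin n₂) (Fin n₂) ℝ) (ξ : ℝ) :
    Matrix (Idx n₁ n₂) (Idx n₁ n₂) ℂ :=
  (Complex.I * (ξ : ℂ)) • A.map (fun a => (a : ℂ)) + (Bmat D).map (fun a => (a : ℂ))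

open scoped InnerProductSpace

variable {E : Type*} [NormedAddCommGroup E] [InnerProductSpace ℂ E]

/-- The weight `ξ / max(1, ξ²)` of the correction term in the Lyapunov functional; multiplied
by `ξ` it gives the decay rate `min(1, ξ²)`. -/
def lyapunovWeight (ξ : ℝ) : ℝ := ξ / max 1 (ξ ^ 2)

theorem lyapunovWeight_mul_self (ξ : ℝ) : lyapunovWeight ξ * ξ = min 1 (ξ ^ 2) := by
  unfold lyapunovWeight
  rcases le_total 1 (ξ ^ 2) with h | h
  · have : ξ ≠ 0 := by rintro rfl; norm_num at h
    rw [max_eq_right h, min_eq_left h]; field_simp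
  · rw [max_eq_left h, min_eq_right h]; ring

theorem lyapunovWeight_sq_le (ξ : ℝ) : lyapunovWeight ξ ^ 2 ≤ min 1 (ξ ^ 2) := by
  unfold lyapunovWeight
  rcases le_total 1 (ξ ^ 2) with h | h
  · have : 0 < ξ ^ 2 := by linarith
    rw [max_eq_right h, min_eq_left h, div_pow, div_le_one (by positivity)]
    nlinarith
  · rw [max_eq_left h, min_eq_right h, div_one]

/-- The vector field `v ↦ -(iξa + b)v` of the Fourier-mode equation. -/
def modeField (a b : E →L[ℂ] E) (ξ : ℝ) (v : E) : E :=
  -((Complex.I * (ξ : ℂ)) • a v + b v)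

/-- The derivative of the quadratic form `v ↦ Re ⟪v, S v⟫` at `v` in the direction `w`. -/
def formDeriv (S : E →L[ℂ] E) (w v : E) : ℝ := (⟪w, S v⟫_ℂ + ⟪v, S w⟫_ℂ).re

/-- The form `Im ⟪p v, p a v⟫` produces dissipation of `‖p a v‖²` along the flow, up to `‖p v‖²`,
`‖b v‖²` and an arbitrarily small multiple of `‖v‖²`. -/
theorem commutator_estimate [CompleteSpace E] (a b p : E →L[ℂ] E) {δ : ℝ} (hδ : 0 < δ) :
    ∃ S : E →L[ℂ] E, ∃ C : ℝ, 0 ≤ C ∧ ∀ (ξ : ℝ) (v : E),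
      min 1 (ξ ^ 2) * ‖p (a v)‖ ^ 2 ≤
        lyapunovWeight ξ * formDeriv S (modeField a b ξ v) v + δ * (min 1 (ξ ^ 2) * ‖v‖ ^ 2) +
          C * (min 1 (ξ ^ 2) * ‖p v‖ ^ 2 + ‖b v‖ ^ 2) := by
  set q : E →L[ℂ] E := p.comp a with hq
  set r : E →L[ℂ] E := q.comp a with hr
  set K : ℝ := 2 * (‖p‖ * ‖q‖) with hK
  refine ⟨(-Complex.I) • (ContinuousLinearMap.adjoint p).comp q,
    ‖r‖ ^ 2 / (2 * δ) + K ^ 2 / (2 * δ), by positivity, fun ξ v => ?_⟩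
  have hθ := lyapunovWeight_mul_self ξ
  have hθ2 := lyapunovWeight_sq_le ξ
  set θ := lyapunovWeight ξ
  set m := min 1 (ξ ^ 2)
  have hm : 0 ≤ m := by positivity
  have key : formDeriv ((-Complex.I) • (ContinuousLinearMap.adjoint p).comp q)
      (modeField a b ξ v) v = ξ * ‖q v‖ ^ 2 - ξ * (⟪p v, r v⟫_ℂ).re
        - (⟪p (b v), q v⟫_ℂ).im - (⟪p v, q (b v)⟫_ℂ).im := by
    have e1 : p (a v) = q v := rfl
    have e2 : q (a v) = r v := rfl
    have e3 : (⟪q v, q v⟫_ℂ).re = ‖q v‖ ^ 2 := inner_self_eq_norm_sq (𝕜 := ℂ) (q v)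
    simp only [formDeriv, modeField, _root_.smul_apply,
      ContinuousLinearMap.comp_apply, inner_smul_right, ContinuousLinearMap.adjoint_inner_right,
      map_neg, map_add, map_smul, e1, e2, inner_neg_left, inner_neg_right, inner_add_left,
      inner_add_right, inner_smul_left]
    simp [← e3]
    ring
  have h1 : (⟪p v, r v⟫_ℂ).re ≤ ‖p v‖ * (‖r‖ * ‖v‖) :=
    (re_inner_le_norm (𝕜 := ℂ) _ _).trans (by gcongr; exact r.le_opNorm v)
  have h2 : |(⟪p (b v), q v⟫_ℂ).im| ≤ (‖p‖ * ‖b v‖) * (‖q‖ * ‖v‖) :=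
    (Complex.abs_im_le_norm _).trans ((norm_inner_le_norm _ _).trans
      (by gcongr; exacts [p.le_opNorm _, q.le_opNorm _]))
  have h3 : |(⟪p v, q (b v)⟫_ℂ).im| ≤ (‖p‖ * ‖v‖) * (‖q‖ * ‖b v‖) :=
    (Complex.abs_im_le_norm _).trans ((norm_inner_le_norm _ _).trans
      (by gcongr; exacts [p.le_opNorm _, q.le_opNorm _]))
  have h4 : θ * ((⟪p (b v), q v⟫_ℂ).im + (⟪p v, q (b v)⟫_ℂ).im) ≤ |θ| * ‖v‖ * (K * ‖b v‖) := by
    refine (le_abs_self _).trans ?_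
    rw [abs_mul, mul_assoc]
    gcongr
    refine (abs_add_le _ _).trans ?_
    rw [hK]; linarith
  have young : ∀ x y : ℝ, x * y ≤ δ / 2 * x ^ 2 + y ^ 2 / (2 * δ) := by
    intro x y
    have : δ / 2 * x ^ 2 + y ^ 2 / (2 * δ) - x * y = (δ * x - y) ^ 2 / (2 * δ) := by
      field_simp; ring
    have : 0 ≤ (δ * x - y) ^ 2 / (2 * δ) := by positivity
    linarith
  have h5 := young ‖v‖ (‖r‖ * ‖p v‖)
  have h6 := young (|θ| * ‖v‖) (K * ‖b v‖)
  rw [mul_pow, sq_abs] at h6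
  have h7 : δ / 2 * (θ ^ 2 * ‖v‖ ^ 2) ≤ δ / 2 * (m * ‖v‖ ^ 2) := by gcongr
  have h8 : m * (⟪p v, r v⟫_ℂ).re ≤
      m * (δ / 2 * ‖v‖ ^ 2 + (‖r‖ * ‖p v‖) ^ 2 / (2 * δ)) := by
    gcongr; linarith
  have h9 : 0 ≤ K ^ 2 / (2 * δ) * (m * ‖p v‖ ^ 2) := by positivity
  have h10 : 0 ≤ ‖r‖ ^ 2 / (2 * δ) * ‖b v‖ ^ 2 := by positivity
  have e : θ * formDeriv ((-Complex.I) • (ContinuousLinearMap.adjoint p).comp q)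
      (modeField a b ξ v) v = m * ‖q v‖ ^ 2 - m * (⟪p v, r v⟫_ℂ).re
        - θ * ((⟪p (b v), q v⟫_ℂ).im + (⟪p v, q (b v)⟫_ℂ).im) := by
    rw [key, ← hθ]; ring
  rw [e]
  change m * ‖q v‖ ^ 2 ≤ _
  have e5 : (‖r‖ * ‖p v‖) ^ 2 / (2 * δ) = ‖r‖ ^ 2 / (2 * δ) * ‖p v‖ ^ 2 := by ring
  have e6 : (K * ‖b v‖) ^ 2 / (2 * δ) = K ^ 2 / (2 * δ) * ‖b v‖ ^ 2 := by ring
  rw [e5] at h8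
  rw [e6] at h6
  linarith

theorem iterate_estimate [CompleteSpace E] (a b : E →L[ℂ] E) (k : ℕ) :
    ∀ δ : ℝ, 0 < δ → ∃ S : E →L[ℂ] E, ∃ C : ℝ, 0 ≤ C ∧ ∀ (ξ : ℝ) (v : E),
      min 1 (ξ ^ 2) * ‖b ((a ^ k) v)‖ ^ 2 ≤
        lyapunovWeight ξ * formDeriv S (modeField a b ξ v) v + δ * (min 1 (ξ ^ 2) * ‖v‖ ^ 2) +
          C * ‖b v‖ ^ 2 := by
  induction k with
  | zero =>
    intro δ hδ
    refine ⟨0, 1, zero_le_one, fun ξ v => ?_⟩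
    have h1 : min 1 (ξ ^ 2) * ‖b v‖ ^ 2 ≤ 1 * ‖b v‖ ^ 2 := by gcongr; exact min_le_left _ _
    have h2 : 0 ≤ δ * (min 1 (ξ ^ 2) * ‖v‖ ^ 2) := by positivity
    simp [formDeriv] at *
    linarith
  | succ k ih =>
    intro δ hδ
    obtain ⟨S, C, hC, h⟩ := commutator_estimate a b (b.comp (a ^ k)) (half_pos hδ)
    obtain ⟨S', C', hC', h'⟩ := ih (δ / (2 * (C + 1))) (by positivity)
    refine ⟨S + (C : ℂ) • S', C + C * C', by positivity, fun ξ v => ?_⟩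
    have h1 := h ξ v
    have h2 := mul_le_mul_of_nonneg_left (h' ξ v) hC
    have e : formDeriv (S + (C : ℂ) • S') (modeField a b ξ v) v =
        formDeriv S (modeField a b ξ v) v + C * formDeriv S' (modeField a b ξ v) v := by
      simp [formDeriv]; ring
    have h3 : C * (δ / (2 * (C + 1))) ≤ δ / 2 := by
      rw [mul_div_assoc', div_le_div_iff₀ (by positivity) (by positivity)]; nlinarith
    have h4 : C * (δ / (2 * (C + 1))) * (min 1 (ξ ^ 2) * ‖v‖ ^ 2) ≤
      δ / 2 * (min 1 (ξ ^ 2) * ‖v‖ ^ 2) := by gcongr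
    have e' : (a ^ (k + 1)) v = (a ^ k) (a v) := by rw [pow_succ]; rfl
    rw [e, e']
    simp only [ContinuousLinearMap.comp_apply] at h1
    linarith

theorem sum_iterate_estimate [CompleteSpace E] (a b : E →L[ℂ] E) (N : ℕ) {δ : ℝ} (hδ : 0 < δ) :
    ∃ S : E →L[ℂ] E, ∃ C : ℝ, 0 ≤ C ∧ ∀ (ξ : ℝ) (v : E),
      min 1 (ξ ^ 2) * ∑ k : Fin N, ‖b ((a ^ (k : ℕ)) v)‖ ^ 2 ≤
        lyapunovWeight ξ * formDeriv S (modeField a b ξ v) v +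
          N * δ * (min 1 (ξ ^ 2) * ‖v‖ ^ 2) + C * ‖b v‖ ^ 2 := by
  choose S C hC h using fun k : Fin N => iterate_estimate a b k δ hδ
  refine ⟨∑ k, S k, ∑ k, C k, Finset.sum_nonneg fun k _ => hC k, fun ξ v => ?_⟩
  have := Finset.sum_le_sum fun k (_ : k ∈ Finset.univ) => h k ξ v
  rw [Finset.mul_sum]
  refine this.trans (le_of_eq ?_)
  simp only [Finset.sum_add_distrib, Finset.sum_const, Finset.card_univ, Fintype.card_fin,
    nsmul_eq_mul, ← Finset.mul_sum, ← Finset.sum_mul, mul_assoc]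
  simp [formDeriv, Finset.sum_add_distrib]

theorem exists_norm_sq_le_sum_iterate [FiniteDimensional ℂ E] (a b : E →L[ℂ] E) (N : ℕ)
    (h : ∀ v, (∀ k < N, b ((a ^ k) v) = 0) → v = 0) :
    ∃ K : ℝ, 0 < K ∧ ∀ v, ‖v‖ ^ 2 ≤ K * ∑ k : Fin N, ‖b ((a ^ (k : ℕ)) v)‖ ^ 2 := by
  let T : E →ₗ[ℂ] PiLp 2 (fun _ : Fin N => E) :=
    (WithLp.linearEquiv 2 ℂ (Fin N → E)).symm.toLinearMap ∘ₗ
      LinearMap.pi fun k : Fin N => (b.comp (a ^ (k : ℕ))).toLinearMap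
  have hT : ∀ v (k : Fin N), T v k = b ((a ^ (k : ℕ)) v) := fun v k => rfl
  obtain ⟨K, hK, hT'⟩ := LinearMap.exists_antilipschitzWith T (by
    rw [LinearMap.ker_eq_bot']
    intro v hv
    refine h v fun k hk => ?_
    rw [← hT v ⟨k, hk⟩, hv]; rfl)
  refine ⟨(K : ℝ) ^ 2, by positivity, fun v => ?_⟩
  have h1 : ‖v‖ ≤ K * ‖T v‖ := hT'.le_mul_norm (map_zero T) v
  have h2 : ‖v‖ ^ 2 ≤ (K * ‖T v‖) ^ 2 := by gcongr
  rw [mul_pow, PiLp.norm_sq_eq_of_L2] at h2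
  exact h2

theorem abs_lyapunovWeight_le_one (ξ : ℝ) : |lyapunovWeight ξ| ≤ 1 :=
  (sq_le_one_iff_abs_le_one _).1 ((lyapunovWeight_sq_le ξ).trans (min_le_left _ _))

theorem formDeriv_one_modeField [CompleteSpace E] {a : E →L[ℂ] E} (ha : IsSelfAdjoint a)
    (s : E →L[ℂ] E) (ξ : ℝ) (v : E) :
    formDeriv 1 (modeField a ((ContinuousLinearMap.adjoint s).comp s) ξ v) v =
      -2 * ‖s v‖ ^ 2 := by
  have h1 : ⟪a v, v⟫_ℂ = ⟪v, a v⟫_ℂ := by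
    rw [← ContinuousLinearMap.adjoint_inner_right,
      ContinuousLinearMap.isSelfAdjoint_iff'.1 ha]
  have e3 : (⟪s v, s v⟫_ℂ).re = ‖s v‖ ^ 2 := inner_self_eq_norm_sq (𝕜 := ℂ) (s v)
  simp only [formDeriv, modeField, ContinuousLinearMap.comp_apply, inner_neg_left,
    inner_neg_right, inner_add_left, inner_add_right, inner_smul_left, inner_smul_right,
    ContinuousLinearMap.adjoint_inner_right, ContinuousLinearMap.adjoint_inner_left,
    one_apply_eq_self, h1]
  simp [← e3]
  ring

theorem hasDerivWithinAt_re_inner (S : E →L[ℂ] E) {V : ℝ → E} {w : E} {s : Set ℝ} {t : ℝ}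
    (hV : HasDerivWithinAt V w s t) :
    HasDerivWithinAt (fun t => (⟪V t, S (V t)⟫_ℂ).re) (formDeriv S w (V t)) s t := by
  have h1 : HasDerivWithinAt (fun t => S (V t)) (S w) s t :=
    (S.restrictScalars ℝ).hasFDerivAt.comp_hasDerivWithinAt t hV
  have h2 := Complex.reCLM.hasFDerivAt.comp_hasDerivWithinAt t (hV.inner ℂ h1)
  refine h2.congr_deriv ?_
  simp [formDeriv, add_comm]


theorem exists_lyapunov [FiniteDimensional ℂ E] [CompleteSpace E] {a : E →L[ℂ] E}
    (ha : IsSelfAdjoint a) {s b : E →L[ℂ] E} (hb : b = (ContinuousLinearMap.adjoint s).comp s)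
    (N : ℕ) (h : ∀ v, (∀ k < N, b ((a ^ k) v) = 0) → v = 0) :
    ∃ S : E →L[ℂ] E, ∃ γ : ℝ, 0 < γ ∧ ‖S‖ ≤ 1 / 2 ∧ ∀ (ξ : ℝ) (v : E),
      formDeriv 1 (modeField a b ξ v) v - lyapunovWeight ξ * formDeriv S (modeField a b ξ v) v ≤
        -(γ * min 1 (ξ ^ 2) * ‖v‖ ^ 2) := by
  obtain ⟨K, hK, hKv⟩ := exists_norm_sq_le_sum_iterate a b N h
  obtain ⟨S, C, hC, hS⟩ := sum_iterate_estimate a b N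
    (δ := 1 / (2 * K * (N + 1))) (by positivity)
  set R := ‖ContinuousLinearMap.adjoint s‖ ^ 2 with hR
  set η : ℝ := 1 / (1 + C * R + 2 * ‖S‖) with hη
  have hηpos : 0 < η := by positivity
  have hη1 : η * (C * R) ≤ 1 := by
    rw [hη, one_div_mul_eq_div, div_le_one (by positivity)]
    linarith [norm_nonneg S]
  have hη2 : η * ‖S‖ ≤ 1 / 2 := by
    rw [hη, one_div_mul_eq_div, div_le_div_iff₀ (by positivity) (by positivity)]
    nlinarith [mul_nonneg hC (sq_nonneg ‖ContinuousLinearMap.adjoint s‖)]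
  refine ⟨(η : ℂ) • S, η / (2 * K), by positivity, ?_, fun ξ v => ?_⟩
  · rwa [norm_smul, Complex.norm_real, Real.norm_of_nonneg hηpos.le]
  have e : formDeriv ((η : ℂ) • S) (modeField a b ξ v) v =
      η * formDeriv S (modeField a b ξ v) v := by
    simp [formDeriv]; ring
  have e0 : formDeriv 1 (modeField a b ξ v) v = -2 * ‖s v‖ ^ 2 := by
    rw [hb]; exact formDeriv_one_modeField ha s ξ v
  have hbv : ‖b v‖ ^ 2 ≤ R * ‖s v‖ ^ 2 := by
    rw [hR, ← mul_pow, hb]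
    gcongr
    exact (ContinuousLinearMap.adjoint s).le_opNorm (s v)
  have hS' := hS ξ v
  have hm : 0 ≤ min 1 (ξ ^ 2) := by positivity
  set m := min 1 (ξ ^ 2)
  have h1 : m * (‖v‖ ^ 2 / K) ≤ m * ∑ k : Fin N, ‖b ((a ^ (k : ℕ)) v)‖ ^ 2 := by
    gcongr
    rw [div_le_iff₀' hK]
    exact hKv v
  have h2 : (N : ℝ) * (1 / (2 * K * (N + 1))) ≤ 1 / (2 * K) := by
    rw [mul_one_div, div_le_div_iff₀ (by positivity) (by positivity)]
    nlinarith
  have h3 : (N : ℝ) * (1 / (2 * K * (N + 1))) * (m * ‖v‖ ^ 2) ≤ 1 / (2 * K) * (m * ‖v‖ ^ 2) := by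
    gcongr
  have h4 : C * ‖b v‖ ^ 2 ≤ C * (R * ‖s v‖ ^ 2) := by gcongr
  have h5 : 1 / (2 * K) * (m * ‖v‖ ^ 2) ≤
      lyapunovWeight ξ * formDeriv S (modeField a b ξ v) v + C * R * ‖s v‖ ^ 2 := by
    have : m * (‖v‖ ^ 2 / K) = 2 * (1 / (2 * K) * (m * ‖v‖ ^ 2)) := by field_simp
    linarith
  have h6 := mul_le_mul_of_nonneg_left h5 hηpos.le
  have h7 : η * (C * R) * ‖s v‖ ^ 2 ≤ 1 * ‖s v‖ ^ 2 := by gcongr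
  have h8 : η * (1 / (2 * K) * (m * ‖v‖ ^ 2)) = η / (2 * K) * m * ‖v‖ ^ 2 := by ring
  rw [e, e0]
  have := sq_nonneg ‖s v‖
  linarith

theorem le_exp_mul_of_hasDerivWithinAt_le {f f' : ℝ → ℝ} {γ : ℝ}
    (hf : ∀ t ∈ Set.Ici (0 : ℝ), HasDerivWithinAt f (f' t) (Set.Ici 0) t)
    (hf' : ∀ t ∈ Set.Ici (0 : ℝ), f' t ≤ -(γ * f t)) {t : ℝ} (ht : 0 ≤ t) :
    f t ≤ Real.exp (-(γ * t)) * f 0 := by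
  have hg : ∀ t ∈ Set.Ici (0 : ℝ), HasDerivWithinAt (fun t => Real.exp (γ * t) * f t)
      (Real.exp (γ * t) * γ * f t + Real.exp (γ * t) * f' t) (Set.Ici 0) t := fun t ht =>
    (((hasDerivAt_id t).const_mul γ).exp.hasDerivWithinAt.mul (hf t ht)).congr_deriv (by simp)
  have hanti : AntitoneOn (fun t => Real.exp (γ * t) * f t) (Set.Ici 0) := by
    refine antitoneOn_of_hasDerivWithinAt_nonpos (convex_Ici 0)
      (fun t ht => (hg t ht).continuousWithinAt)
      (fun t ht => (hg t (interior_subset ht)).mono interior_subset) fun t ht => ?_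
    have := mul_le_mul_of_nonneg_left (hf' t (interior_subset ht)) (Real.exp_pos (γ * t)).le
    linarith
  have := hanti (Set.mem_Ici.2 le_rfl) (Set.mem_Ici.2 ht) ht
  simp only [mul_zero, Real.exp_zero, one_mul] at this
  rw [Real.exp_neg, inv_mul_eq_div, le_div_iff₀' (Real.exp_pos _)]
  exact this

theorem exists_norm_le_exp_mul [FiniteDimensional ℂ E] [CompleteSpace E] {a : E →L[ℂ] E}
    (ha : IsSelfAdjoint a) {s b : E →L[ℂ] E} (hb : b = (ContinuousLinearMap.adjoint s).comp s)
    (N : ℕ) (h : ∀ v, (∀ k < N, b ((a ^ k) v) = 0) → v = 0) :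
    ∃ C : ℝ, 1 ≤ C ∧ ∃ c : ℝ, 0 < c ∧ ∀ (ξ : ℝ) (V : ℝ → E),
      (∀ t ∈ Set.Ici (0 : ℝ), HasDerivWithinAt V (modeField a b ξ (V t)) (Set.Ici 0) t) →
        ∀ t : ℝ, 0 ≤ t → ‖V t‖ ≤ C * Real.exp (-(c * min 1 (ξ ^ 2) * t)) * ‖V 0‖ := by
  obtain ⟨S, γ, hγ, hS, hL⟩ := exists_lyapunov ha hb N h
  refine ⟨2, one_le_two, γ / 3, by positivity, fun ξ V hV t ht => ?_⟩
  have hL := hL ξ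
  have hθ := abs_lyapunovWeight_le_one ξ
  have hm : 0 ≤ min 1 (ξ ^ 2) := by positivity
  set θ := lyapunovWeight ξ
  set m := min 1 (ξ ^ 2)
  have hform : ∀ v, |θ * (⟪v, S v⟫_ℂ).re| ≤ 1 / 2 * ‖v‖ ^ 2 := fun v => by
    have : |(⟪v, S v⟫_ℂ).re| ≤ 1 / 2 * ‖v‖ ^ 2 :=
      calc |(⟪v, S v⟫_ℂ).re| ≤ ‖v‖ * (‖S‖ * ‖v‖) :=
            (Complex.abs_re_le_norm _).trans ((norm_inner_le_norm _ _).trans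
              (by gcongr; exact S.le_opNorm v))
        _ ≤ ‖v‖ * (1 / 2 * ‖v‖) := by gcongr
        _ = 1 / 2 * ‖v‖ ^ 2 := by ring
    rw [abs_mul]
    exact (mul_le_of_le_one_left (abs_nonneg _) hθ).trans this
  have hone : ∀ v : E, (⟪v, (1 : E →L[ℂ] E) v⟫_ℂ).re = ‖v‖ ^ 2 :=
    fun v => inner_self_eq_norm_sq (𝕜 := ℂ) v
  have key := le_exp_mul_of_hasDerivWithinAt_le (γ := 2 * (γ / 3) * m)
    (fun t ht => (hasDerivWithinAt_re_inner 1 (hV t ht)).sub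
      ((hasDerivWithinAt_re_inner S (hV t ht)).const_mul θ)) (fun t _ => by
      refine (hL (V t)).trans ?_
      simp only [Pi.sub_apply, hone]
      have h1 := (abs_le.1 (hform (V t))).1
      have h2 : γ * m * (‖V t‖ ^ 2 - θ * (⟪V t, S (V t)⟫_ℂ).re) ≤
          γ * m * (3 / 2 * ‖V t‖ ^ 2) := by gcongr; linarith
      linarith) ht
  simp only [Pi.sub_apply, hone] at key
  have h1 := (abs_le.1 (hform (V t))).2
  have h2 := (abs_le.1 (hform (V 0))).1
  have h3 : Real.exp (-(2 * (γ / 3) * m * t)) = Real.exp (-(γ / 3 * m * t)) ^ 2 := by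
    rw [← Real.exp_nat_mul]; congr 1; push_cast; ring
  rw [h3] at key
  set e := Real.exp (-(γ / 3 * m * t))
  have h4 : e ^ 2 * (‖V 0‖ ^ 2 - θ * (⟪V 0, S (V 0)⟫_ℂ).re) ≤ e ^ 2 * (3 / 2 * ‖V 0‖ ^ 2) := by
    gcongr; linarith
  refine le_of_sq_le_sq ?_ (by positivity)
  nlinarith [mul_nonneg (sq_nonneg e) (sq_nonneg ‖V 0‖)]

section Matrices

variable {n₁ n₂ : ℕ}

theorem Bmat_eq_transpose_mul_self {D : Matrix (Fin n₂) (Fin n₂) ℝ} (hD : D.PosSemidef) :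
    ∃ P : Matrix (Idx n₁ n₂) (Idx n₁ n₂) ℝ, Bmat D = Pᵀ * P := by
  open scoped MatrixOrder Matrix.Norms.L2Operator in
  obtain ⟨P, hP⟩ := CStarAlgebra.nonneg_iff_eq_star_mul_self.mp hD.nonneg
  refine ⟨Matrix.fromBlocks 0 0 0 P, ?_⟩
  rw [Bmat, Matrix.fromBlocks_transpose, Matrix.fromBlocks_multiply, hP,
    Matrix.star_eq_conjTranspose, Matrix.conjTranspose_eq_transpose_of_trivial]
  simp

theorem eq_zero_of_complex_mulVec {A B : Matrix (Idx n₁ n₂) (Idx n₁ n₂) ℝ}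
    (hK : KalmanCondition A B) (v : Idx n₁ n₂ → ℂ)
    (hv : ∀ k < n₁ + n₂,
      ((B * A ^ k).map (fun x => (x : ℂ))).mulVec v = 0) : v = 0 := by
  have hre : (fun i => (v i).re) = 0 := hK _ fun k hk => by
    ext i
    have := congrArg Complex.re (congrFun (hv k hk) i)
    simpa [Matrix.mulVec, dotProduct, Complex.re_sum] using this
  have him : (fun i => (v i).im) = 0 := hK _ fun k hk => by
    ext i
    have := congrArg Complex.im (congrFun (hv k hk) i)
    simpa [Matrix.mulVec, dotProduct, Complex.im_sum] using this
  ext i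
  exact Complex.ext (congrFun hre i) (congrFun him i)

/-- The operator on `ℂⁿ` with the Euclidean norm given by a real matrix. -/
def complexOperator (M : Matrix (Idx n₁ n₂) (Idx n₁ n₂) ℝ) :
    EuclideanSpace ℂ (Idx n₁ n₂) →L[ℂ] EuclideanSpace ℂ (Idx n₁ n₂) :=
  Matrix.toEuclideanCLM (𝕜 := ℂ) (M.map (fun x => (x : ℂ)))

theorem complexOperator_mul (M N : Matrix (Idx n₁ n₂) (Idx n₁ n₂) ℝ) :
    complexOperator (M * N) = complexOperator M * complexOperator N := by
  rw [complexOperator, complexOperator, complexOperator, ← map_mul]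
  congr 1
  exact Matrix.map_mul (f := Complex.ofRealHom)

theorem complexOperator_pow (M : Matrix (Idx n₁ n₂) (Idx n₁ n₂) ℝ) (k : ℕ) :
    complexOperator (M ^ k) = complexOperator M ^ k := by
  rw [complexOperator, complexOperator, ← map_pow]
  congr 1
  exact Matrix.map_pow M Complex.ofRealHom k

theorem complexOperator_transpose (M : Matrix (Idx n₁ n₂) (Idx n₁ n₂) ℝ) :
    complexOperator Mᵀ = star (complexOperator M) := by
  rw [complexOperator, complexOperator, ← map_star]
  congr 1
  ext i j
  simp

theorem modeField_complexOperator (A : Matrix (Idx n₁ n₂) (Idx n₁ n₂) ℝ)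
    (D : Matrix (Fin n₂) (Fin n₂) ℝ) (ξ : ℝ) (v : Idx n₁ n₂ → ℂ) :
    modeField (complexOperator A) (complexOperator (Bmat D)) ξ (WithLp.toLp 2 v) =
      WithLp.toLp 2 (-(fourierModeMatrix A D ξ).mulVec v) := by
  simp only [modeField, complexOperator, Matrix.toEuclideanCLM_toLp, fourierModeMatrix,
    Matrix.add_mulVec, Matrix.smul_mulVec, WithLp.toLp_neg, WithLp.toLp_add, WithLp.toLp_smul]

end Matrices

/-- Frequency-wise exponential decay for the Fourier-mode ODE
`V′(t) = −(iξA + B)V(t)`: under the Kalman rank condition there are `C ≥ 1`, `c > 0`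
such that `|V(t)| ≤ C e^{−c·min(1,ξ²)·t} |V(0)|` for all `ξ ∈ ℝ` and `t ≥ 0`. -/
theorem fourier_mode_exponential_decay
    {n₁ n₂ : ℕ} (hn₁ : 1 ≤ n₁) (hn₂ : 1 ≤ n₂)
    (A : Matrix (Idx n₁ n₂) (Idx n₁ n₂) ℝ) (hA : A.IsSymm)
    (D : Matrix (Fin n₂) (Fin n₂) ℝ) (hD : D.IsSymm) (hDpos : D.PosDef)
    (κ : ℝ) (hκ : 0 < κ)
    (hdiss : ∀ X : Fin n₂ → ℝ, κ * ∑ j, (X j) ^ 2 ≤ ∑ j, D.mulVec X j * X j)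
    (hK : KalmanCondition A (Bmat D)) :
    ∃ C : ℝ, 1 ≤ C ∧ ∃ c : ℝ, 0 < c ∧
      ∀ ξ : ℝ, ∀ V : ℝ → Idx n₁ n₂ → ℂ,
        (∀ t ∈ Set.Ici (0 : ℝ),
          HasDerivWithinAt V (-(fourierModeMatrix A D ξ).mulVec (V t)) (Set.Ici 0) t) →
        ∀ t : ℝ, 0 ≤ t →
          Real.sqrt (∑ i, ‖V t i‖ ^ 2) ≤
            C * Real.exp (-(c * min 1 (ξ ^ 2) * t)) * Real.sqrt (∑ i, ‖V 0 i‖ ^ 2) := by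
  obtain ⟨P, hP⟩ := Bmat_eq_transpose_mul_self (n₁ := n₁) hDpos.posSemidef
  have ha : IsSelfAdjoint (complexOperator A) := by
    rw [IsSelfAdjoint, ← complexOperator_transpose, hA]
  have hb : complexOperator (Bmat D) =
      (ContinuousLinearMap.adjoint (complexOperator P)).comp (complexOperator P) := by
    rw [hP, complexOperator_mul, complexOperator_transpose]; rfl
  obtain ⟨C, hC, c, hc, h⟩ := exists_norm_le_exp_mul ha hb (n₁ + n₂) (fun v hv => by
    have := eq_zero_of_complex_mulVec hK v.ofLp fun k hk => by
      have hk' := hv k hk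
      rw [← complexOperator_pow, ← mul_apply_eq_comp, ← complexOperator_mul] at hk'
      rw [← Matrix.ofLp_toEuclideanCLM]
      exact congrArg WithLp.ofLp hk'
    ext i
    exact congrFun this i)
  refine ⟨C, hC, c, hc, fun ξ V hV t ht => ?_⟩
  have := h ξ (fun t => WithLp.toLp 2 (V t)) (fun t ht => by
    rw [modeField_complexOperator]
    exact (PiLp.continuousLinearEquiv 2 ℝ
      (fun _ : Idx n₁ n₂ => ℂ)).symm.hasFDerivAt.comp_hasDerivWithinAt t (hV t ht)) t ht
  simpa only [EuclideanSpace.norm_eq] using this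
end
end

section
/- Corrector estimate (Lemma 3.1): For any constant ε₀ > 0 there exist positive constants ε₁, …, ε_{n−1} (depending only on ε₀, n, A, B) such that for every classical solution U of the linear partially dissipative system, the corrector functional 𝓘(t) := Σ_{k=1}^{n−1} ε_k ⟨BA^{k−1}U(t), BA^k ∂ₓU(t)⟩_{L²} is differentiable in t and satisfies, for all t > 0, (d/dt)𝓘(t) + ½ Σ_{k=1}^{n−1} ε_k ‖BA^k ∂ₓU(t)‖²_{L²} ≤ ε₀‖U₂(t)‖²_{L²} + ε₀‖∂ₓU₂(t)‖²_{L²}. -/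
open MeasureTheory Matrix Finset

noncomputable section

/-- Spatial derivative `∂ₓU(t,x)` (time is the first argument). -/
def pdx {E : Type*} [NormedAddCommGroup E] [NormedSpace ℝ E]
    (U : ℝ → ℝ → E) (t x : ℝ) : E :=
  deriv (fun y => U t y) x

/-- A classical solution of `∂ₜU + A ∂ₓU = −BU` on `ℝ × [0,∞)`:
a smooth function that is Schwartz in `x`, locally uniformly in `t ≥ 0`,
and solves the equation for `t ≥ 0`. -/
structure IsClassicalSolution {n₁ n₂ : ℕ} (A : Matrix (Idx n₁ n₂) (Idx n₁ n₂) ℝ)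
    (D : Matrix (Fin n₂) (Fin n₂) ℝ) (U : ℝ → ℝ → Idx n₁ n₂ → ℝ) : Prop where
  smooth : ContDiff ℝ (⊤ : ℕ∞) (fun p : ℝ × ℝ => U p.1 p.2)
  decay : ∀ (k m : ℕ) (T : ℝ), ∃ C : ℝ, ∀ t ∈ Set.Icc (0 : ℝ) T, ∀ x : ℝ,
      |x| ^ k * ‖iteratedDeriv m (fun y => U t y) x‖ ≤ C
  eqn : ∀ (t x : ℝ), 0 ≤ t →
      deriv (fun s => U s x) t + A.mulVec (pdx U t x) + (Bmat D).mulVec (U t x) = 0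

/-- Squared `L²` norm of a vector-valued function on `ℝ`. -/
def sqL2 {ι : Type*} [Fintype ι] (f : ℝ → ι → ℝ) : ℝ := ∫ x, ∑ i, (f x i) ^ 2

/-- Squared `H¹` norm. -/
def sqH1 {ι : Type*} [Fintype ι] (f : ℝ → ι → ℝ) : ℝ := sqL2 f + sqL2 (deriv f)

/-- Squared weighted `L²` norm `‖|x|^μ f‖²_{L²}`. -/
def wSqL2 {ι : Type*} [Fintype ι] (μ : ℝ) (f : ℝ → ι → ℝ) : ℝ :=
  ∫ x, |x| ^ (2 * μ) * ∑ i, (f x i) ^ 2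

/-- The dissipated component `U₂(t)`. -/
def U2part {n₁ n₂ : ℕ} (U : ℝ → ℝ → Idx n₁ n₂ → ℝ) (t : ℝ) : ℝ → Fin n₂ → ℝ :=
  fun x j => U t x (Sum.inr j)

/-- The corrector functional `𝓘(t) = ∑_{k=1}^{n−1} ε_k ⟨BA^{k−1}U(t), BA^k ∂ₓU(t)⟩_{L²}`. -/
def corrector {n₁ n₂ : ℕ} (A : Matrix (Idx n₁ n₂) (Idx n₁ n₂) ℝ)
    (D : Matrix (Fin n₂) (Fin n₂) ℝ) (ε : ℕ → ℝ) (U : ℝ → ℝ → Idx n₁ n₂ → ℝ)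
    (t : ℝ) : ℝ :=
  ∑ k ∈ Finset.Ico 1 (n₁ + n₂), ε k *
    ∫ x, ∑ i, ((Bmat D * A ^ (k - 1)).mulVec (U t x) i) *
      ((Bmat D * A ^ k).mulVec (pdx U t x) i)

section SpaceTimeCalculus

variable {E : Type*} [NormedAddCommGroup E] [NormedSpace ℝ E] {U : ℝ → ℝ → E}

lemma hasDerivAt_time_fderiv (hU : ContDiff ℝ (⊤ : ℕ∞) (fun p : ℝ × ℝ => U p.1 p.2)) (t x : ℝ) :
    HasDerivAt (fun s => U s x) (fderiv ℝ (fun p : ℝ × ℝ => U p.1 p.2) (t, x) (1, 0)) t := by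
  have h := (hU.differentiable (by simp) (t, x)).hasFDerivAt
  exact h.comp_hasDerivAt (f := fun s : ℝ => (s, x)) t
    ((hasDerivAt_id t).prodMk (hasDerivAt_const t x))

lemma hasDerivAt_space_fderiv (hU : ContDiff ℝ (⊤ : ℕ∞) (fun p : ℝ × ℝ => U p.1 p.2)) (t x : ℝ) :
    HasDerivAt (U t) (fderiv ℝ (fun p : ℝ × ℝ => U p.1 p.2) (t, x) (0, 1)) x := by
  have h := (hU.differentiable (by simp) (t, x)).hasFDerivAt
  exact h.comp_hasDerivAt (f := fun y : ℝ => (t, y)) x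
    ((hasDerivAt_const x t).prodMk (hasDerivAt_id x))

lemma hasDerivAt_pdx (hU : ContDiff ℝ (⊤ : ℕ∞) (fun p : ℝ × ℝ => U p.1 p.2)) (t x : ℝ) :
    HasDerivAt (U t) (pdx U t x) x :=
  (hasDerivAt_space_fderiv hU t x).differentiableAt.hasDerivAt

lemma contDiff_fderiv_apply (hU : ContDiff ℝ (⊤ : ℕ∞) (fun p : ℝ × ℝ => U p.1 p.2)) (v : ℝ × ℝ) :
    ContDiff ℝ (⊤ : ℕ∞) (fun p => fderiv ℝ (fun p : ℝ × ℝ => U p.1 p.2) p v) :=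
  (hU.fderiv_right (m := (⊤ : ℕ∞)) (by simp)).clm_apply contDiff_const

lemma contDiff_pdx (hU : ContDiff ℝ (⊤ : ℕ∞) (fun p : ℝ × ℝ => U p.1 p.2)) :
    ContDiff ℝ (⊤ : ℕ∞) (fun p : ℝ × ℝ => pdx U p.1 p.2) := by
  convert contDiff_fderiv_apply hU (0, 1) using 2 with p
  exact (hasDerivAt_space_fderiv hU p.1 p.2).deriv

/-- Time and space derivatives commute. -/
lemma hasDerivAt_time_pdx (hU : ContDiff ℝ (⊤ : ℕ∞) (fun p : ℝ × ℝ => U p.1 p.2)) (t x : ℝ) :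
    HasDerivAt (fun s => pdx U s x) (pdx (fun s y => deriv (fun r => U r y) s) t x) t := by
  set G : ℝ × ℝ → E := fun p => U p.1 p.2 with hG
  have hG' : Differentiable ℝ (fderiv ℝ G) :=
    (hU.fderiv_right (m := (⊤ : ℕ∞)) (by simp)).differentiable (by simp)
  have hspace : (fun s => pdx U s x) = fun s => fderiv ℝ G (s, x) (0, 1) :=
    funext fun s => (hasDerivAt_space_fderiv hU s x).deriv
  have htime : (fun s y => deriv (fun r => U r y) s) = fun s y => fderiv ℝ G (s, y) (1, 0) :=
    funext fun s => funext fun y => (hasDerivAt_time_fderiv hU s y).deriv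
  have hsymm : IsSymmSndFDerivAt ℝ G (t, x) :=
    hU.contDiffAt.isSymmSndFDerivAt (by
      rw [minSmoothness_of_isRCLikeNormedField]
      exact WithTop.coe_le_coe.2 (le_top : (2 : ℕ∞) ≤ ⊤))
  have h₁ := hasDerivAt_time_fderiv (U := fun s y => fderiv ℝ G (s, y) (0, 1))
    (contDiff_fderiv_apply hU (0, 1)) t x
  have h₂ := (hasDerivAt_space_fderiv (U := fun s y => fderiv ℝ G (s, y) (1, 0))
    (contDiff_fderiv_apply hU (1, 0)) t x).deriv
  have hsnd (v w : ℝ × ℝ) :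
      fderiv ℝ (fun p : ℝ × ℝ => fderiv ℝ G (p.1, p.2) v) (t, x) w
        = fderiv ℝ (fderiv ℝ G) (t, x) w v := by
    have := ((hG' (t, x)).hasFDerivAt.clm_apply (hasFDerivAt_const v (t, x))).fderiv
    simp [this]
  rw [hspace, htime]
  unfold pdx
  rw [h₂, hsnd, hsymm.eq, ← hsnd]
  exact h₁

end SpaceTimeCalculus

section Decay

variable {E F : Type*} [NormedAddCommGroup E] [NormedSpace ℝ E]
  [NormedAddCommGroup F] [NormedSpace ℝ F]

lemma norm_bilinear_le_inv_one_add_sq (L : E →L[ℝ] F →L[ℝ] ℝ) {v : E} {w : F} {C C' x : ℝ}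
    (hv : ‖v‖ ≤ C * (1 + x ^ 2)⁻¹) (hw : ‖w‖ ≤ C' * (1 + x ^ 2)⁻¹) :
    ‖L v w‖ ≤ ‖L‖ * C * C' * (1 + x ^ 2)⁻¹ := by
  have hpos : 0 < (1 + x ^ 2)⁻¹ := by positivity
  have hle : (1 + x ^ 2)⁻¹ ≤ 1 := inv_le_one_of_one_le₀ (by nlinarith [sq_nonneg x])
  have hC : 0 ≤ C := nonneg_of_mul_nonneg_left ((norm_nonneg v).trans hv) hpos
  have hC' : 0 ≤ C' := nonneg_of_mul_nonneg_left ((norm_nonneg w).trans hw) hpos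
  calc ‖L v w‖ ≤ ‖L‖ * ‖v‖ * ‖w‖ := L.le_opNorm₂ v w
    _ ≤ ‖L‖ * (C * (1 + x ^ 2)⁻¹) * (C' * 1) := by
        gcongr
        exact hw.trans (by gcongr)
    _ = ‖L‖ * C * C' * (1 + x ^ 2)⁻¹ := by ring

lemma integrable_bilinear_of_decay (L : E →L[ℝ] F →L[ℝ] ℝ) {f : ℝ → E} {g : ℝ → F}
    (hf : Continuous f) (hg : Continuous g)
    (hfd : ∃ C, ∀ x, ‖f x‖ ≤ C * (1 + x ^ 2)⁻¹) (hgd : ∃ C, ∀ x, ‖g x‖ ≤ C * (1 + x ^ 2)⁻¹) :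
    Integrable (fun x => L (f x) (g x)) := by
  obtain ⟨C, hC⟩ := hfd
  obtain ⟨C', hC'⟩ := hgd
  refine (integrable_inv_one_add_sq.const_mul (‖L‖ * C * C')).mono'
    (by fun_prop : Continuous fun x => L (f x) (g x)).aestronglyMeasurable
    (.of_forall fun x => ?_)
  exact norm_bilinear_le_inv_one_add_sq L (hC x) (hC' x)

/-- Decay of all space derivatives, locally uniformly in time. -/
def SpaceDecay (U : ℝ → ℝ → E) : Prop :=
  ∀ (m : ℕ) (T : ℝ), ∃ C : ℝ, ∀ t ∈ Set.Icc (0 : ℝ) T, ∀ x : ℝ,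
    ‖iteratedDeriv m (U t) x‖ ≤ C * (1 + x ^ 2)⁻¹

lemma SpaceDecay.bound {U : ℝ → ℝ → E} (h : SpaceDecay U) (T : ℝ) :
    ∃ C : ℝ, ∀ t ∈ Set.Icc (0 : ℝ) T, ∀ x : ℝ, ‖U t x‖ ≤ C * (1 + x ^ 2)⁻¹ := by
  simpa using h 0 T

lemma SpaceDecay.pdx {U : ℝ → ℝ → E} (h : SpaceDecay U) : SpaceDecay (pdx U) := by
  intro m T
  obtain ⟨C, hC⟩ := h (m + 1) T
  refine ⟨C, fun t ht x => ?_⟩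
  rw [show _root_.pdx U t = deriv (U t) from rfl, ← iteratedDeriv_succ']
  exact hC t ht x

end Decay

/-- Derivative of `∫ L(U, ∂ₓU)` along solutions of `∂ₜU = P ∂ₓU + Q U`. -/
lemma hasDerivAt_integral_bilinear_pdx {E : Type*} [NormedAddCommGroup E] [NormedSpace ℝ E]
    {U : ℝ → ℝ → E} (hU : ContDiff ℝ (⊤ : ℕ∞) (fun p : ℝ × ℝ => U p.1 p.2)) (hd : SpaceDecay U)
    (P Q : E →L[ℝ] E)
    (heq : ∀ t x, 0 ≤ t → deriv (fun s => U s x) t = P (pdx U t x) + Q (U t x))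
    (L : E →L[ℝ] E →L[ℝ] ℝ) {t : ℝ} (ht : 0 < t) :
    Integrable (fun x => L (P (pdx U t x) + Q (U t x)) (pdx U t x)
      - L (pdx U t x) (P (pdx U t x) + Q (U t x))) ∧
    HasDerivAt (fun s => ∫ x, L (U s x) (pdx U s x))
      (∫ x, (L (P (pdx U t x) + Q (U t x)) (pdx U t x)
        - L (pdx U t x) (P (pdx U t x) + Q (U t x)))) t := by
  have hV := contDiff_pdx hU
  have hZ := contDiff_pdx hV
  have cU (s : ℝ) : Continuous (U s) := hU.continuous.comp (Continuous.prodMk_right s)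
  have cV (s : ℝ) : Continuous (pdx U s) := hV.continuous.comp (Continuous.prodMk_right s)
  have cZ (s : ℝ) : Continuous (pdx (pdx U) s) := hZ.continuous.comp (Continuous.prodMk_right s)
  set W : ℝ → ℝ → E := fun s x => P (pdx U s x) + Q (U s x) with hW
  set Wx : ℝ → ℝ → E := fun s x => P (pdx (pdx U) s x) + Q (pdx U s x)
  have hWder (s x : ℝ) : HasDerivAt (W s) (Wx s x) x :=
    (P.hasFDerivAt.comp_hasDerivAt x (hasDerivAt_pdx hV s x)).add
      (Q.hasFDerivAt.comp_hasDerivAt x (hasDerivAt_pdx hU s x))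
  have hUt (s x : ℝ) (hs : 0 ≤ s) : HasDerivAt (fun r => U r x) (W s x) s := by
    simp only [hW, ← heq s x hs]
    exact (hasDerivAt_time_fderiv hU s x).differentiableAt.hasDerivAt
  have hVt (s x : ℝ) (hs : 0 ≤ s) : HasDerivAt (fun r => pdx U r x) (Wx s x) s := by
    have h := hasDerivAt_time_pdx hU s x
    have h' : pdx (fun s y => deriv (fun r => U r y) s) s x = Wx s x := by
      unfold pdx
      rw [show (fun y => deriv (fun r => U r y) s) = W s from funext fun y => heq s y hs]
      exact (hWder s x).deriv
    rwa [h'] at h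
  obtain ⟨CU, hCU⟩ := hd.bound (2 * t)
  obtain ⟨CV, hCV⟩ := hd.pdx.bound (2 * t)
  obtain ⟨CZ, hCZ⟩ := hd.pdx.pdx.bound (2 * t)
  have decayAdd {v w : E} {a b x : ℝ} (hv : ‖v‖ ≤ a * (1 + x ^ 2)⁻¹)
      (hw : ‖w‖ ≤ b * (1 + x ^ 2)⁻¹) :
      ‖P v + Q w‖ ≤ (‖P‖ * a + ‖Q‖ * b) * (1 + x ^ 2)⁻¹ := by
    calc ‖P v + Q w‖ ≤ ‖P‖ * ‖v‖ + ‖Q‖ * ‖w‖ :=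
          (norm_add_le _ _).trans (add_le_add (P.le_opNorm v) (Q.le_opNorm w))
      _ ≤ ‖P‖ * (a * (1 + x ^ 2)⁻¹) + ‖Q‖ * (b * (1 + x ^ 2)⁻¹) := by gcongr
      _ = _ := by ring
  have hCW : ∀ s ∈ Set.Icc 0 (2 * t), ∀ x, ‖W s x‖ ≤ (‖P‖ * CV + ‖Q‖ * CU) * (1 + x ^ 2)⁻¹ :=
    fun s hs x => decayAdd (hCV s hs x) (hCU s hs x)
  have hCWx : ∀ s ∈ Set.Icc 0 (2 * t), ∀ x, ‖Wx s x‖ ≤ (‖P‖ * CZ + ‖Q‖ * CV) * (1 + x ^ 2)⁻¹ :=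
    fun s hs x => decayAdd (hCZ s hs x) (hCV s hs x)
  have cW (s : ℝ) : Continuous (W s) := (P.continuous.comp (cV s)).add (Q.continuous.comp (cU s))
  have cWx (s : ℝ) : Continuous (Wx s) := (P.continuous.comp (cZ s)).add (Q.continuous.comp (cV s))
  have ht' : t ∈ Set.Icc 0 (2 * t) := ⟨ht.le, by linarith⟩
  have iUV := integrable_bilinear_of_decay L (cU t) (cV t) ⟨_, hCU t ht'⟩ ⟨_, hCV t ht'⟩
  have iUW := integrable_bilinear_of_decay L (cU t) (cW t) ⟨_, hCU t ht'⟩ ⟨_, hCW t ht'⟩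
  have iUWx := integrable_bilinear_of_decay L (cU t) (cWx t) ⟨_, hCU t ht'⟩ ⟨_, hCWx t ht'⟩
  have iVW := integrable_bilinear_of_decay L (cV t) (cW t) ⟨_, hCV t ht'⟩ ⟨_, hCW t ht'⟩
  have iWV := integrable_bilinear_of_decay L (cW t) (cV t) ⟨_, hCW t ht'⟩ ⟨_, hCV t ht'⟩
  refine ⟨iWV.sub iVW, ?_⟩
  have hparts : ∫ x, L (U t x) (Wx t x) = -∫ x, L (pdx U t x) (W t x) :=
    integral_bilinear_hasDerivAt_right_eq_neg_left_of_integrable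
      (fun x _ => hasDerivAt_pdx hU t x) (fun x _ => hWder t x) iUWx iVW iUW
  have hnhds : Set.Ioo 0 (2 * t) ∈ nhds t := Ioo_mem_nhds ht (by linarith)
  have key := (hasDerivAt_integral_of_dominated_loc_of_deriv_le (μ := volume)
    (F := fun s x => L (U s x) (pdx U s x))
    (F' := fun s x => L (U s x) (Wx s x) + L (W s x) (pdx U s x))
    (bound := fun x => (‖L‖ * CU * (‖P‖ * CZ + ‖Q‖ * CV)
      + ‖L‖ * (‖P‖ * CV + ‖Q‖ * CU) * CV) * (1 + x ^ 2)⁻¹) hnhds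
    (.of_forall fun s => (by
      have := cU s; have := cV s
      fun_prop : Continuous fun x => L (U s x) (pdx U s x)).aestronglyMeasurable)
    iUV (iUWx.add iWV).aestronglyMeasurable
    (.of_forall fun x s hs => ?_) (integrable_inv_one_add_sq.const_mul _)
    (.of_forall fun x s hs => L.hasDerivAt_of_bilinear
      (fun _ => hUt s x hs.1.le) (fun _ => hVt s x hs.1.le))).2
  · rw [integral_add iUWx iWV, hparts] at key
    rw [integral_sub iWV iVW]
    rwa [neg_add_eq_sub] at key
  · have hs' : s ∈ Set.Icc 0 (2 * t) := ⟨hs.1.le, hs.2.le⟩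
    rw [add_mul]
    exact (norm_add_le _ _).trans (add_le_add
      (norm_bilinear_le_inv_one_add_sq L (hCU s hs' x) (hCWx s hs' x))
      (norm_bilinear_le_inv_one_add_sq L (hCW s hs' x) (hCV s hs' x)))

section Algebra

variable {ι : Type*} [Fintype ι]

lemma mul_dotProduct_le {e δ p q : ℝ} (hδ : 0 ≤ δ) (hp : 0 ≤ p) (hq : 0 ≤ q)
    (h : e ^ 2 ≤ δ ^ 2 * (p * q)) (v w : ι → ℝ) :
    e * (v ⬝ᵥ w) ≤ δ / 2 * (p * (v ⬝ᵥ v) + q * (w ⬝ᵥ w)) := by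
  simp only [dotProduct, mul_sum, ← sum_add_distrib]
  refine sum_le_sum fun i _ => ?_
  have hsq : (2 * e * (v i * w i)) ^ 2 ≤ (δ * (p * v i ^ 2 + q * w i ^ 2)) ^ 2 := by
    calc (2 * e * (v i * w i)) ^ 2 = e ^ 2 * (4 * (v i * w i) ^ 2) := by ring
      _ ≤ δ ^ 2 * (p * q) * (4 * (v i * w i) ^ 2) := by gcongr
      _ ≤ δ ^ 2 * (p * q) * (4 * (v i * w i) ^ 2) + δ ^ 2 * (p * v i ^ 2 - q * w i ^ 2) ^ 2 :=
          le_add_of_nonneg_right (by positivity)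
      _ = _ := by ring
  have := (abs_le_of_sq_le_sq' hsq (by positivity)).2
  nlinarith

lemma dotProduct_self_nonneg (v : ι → ℝ) : 0 ≤ v ⬝ᵥ v :=
  sum_nonneg fun i _ => mul_self_nonneg (v i)

lemma dotProduct_mulVec_self_le (M : Matrix ι ι ℝ) (v : ι → ℝ) :
    M *ᵥ v ⬝ᵥ M *ᵥ v ≤ (∑ i, ∑ j, M i j ^ 2) * (v ⬝ᵥ v) := by
  have hv : v ⬝ᵥ v = ∑ j, v j ^ 2 := sum_congr rfl fun j _ => (sq _).symm
  rw [hv, sum_mul]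
  refine sum_le_sum fun i _ => ?_
  rw [← sq]
  exact sum_mul_sq_le_sq_mul_sq _ _ _

/-- Rapidly decreasing, log-concave weights. -/
lemma exists_weights (n : ℕ) {δ : ℝ} (hδ : 0 < δ) (hδ1 : δ ≤ 1) :
    ∃ e : ℕ → ℝ, e 0 = 1 ∧ (∀ k, 0 < e k) ∧
      (∀ j k, j < k → k < n → e k ≤ δ ^ 2 * e j) ∧
      ∀ k, k + 2 < n → e (k + 1) ^ 2 ≤ δ ^ 2 * (e k * e (k + 2)) := by
  refine ⟨fun k => δ ^ (2 * k * (2 * n - k)), by simp, fun k => by positivity,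
    fun j k hjk hk => ?_, fun k hk => ?_⟩
  · rw [← pow_add]
    refine pow_le_pow_of_le_one hδ.le hδ1 ?_
    obtain ⟨a, rfl⟩ := Nat.exists_eq_add_of_lt hjk
    obtain ⟨b, rfl⟩ := Nat.exists_eq_add_of_lt hk
    rw [show 2 * (j + a + 1 + b + 1) - j = j + 2 * a + 2 * b + 4 by omega,
      show 2 * (j + a + 1 + b + 1) - (j + a + 1) = j + a + 2 * b + 3 by omega]
    nlinarith [Nat.zero_le (j * a), Nat.zero_le (a * b), Nat.zero_le (a * a)]
  · rw [← pow_add, ← pow_add, ← pow_mul]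
    refine pow_le_pow_of_le_one hδ.le hδ1 ?_
    obtain ⟨b, rfl⟩ := Nat.exists_eq_add_of_lt hk
    rw [show 2 * (k + 2 + b + 1) - k = k + 2 * b + 6 by omega,
      show 2 * (k + 2 + b + 1) - (k + 1) = k + 2 * b + 5 by omega,
      show 2 * (k + 2 + b + 1) - (k + 2) = k + 2 * b + 4 by omega]
    nlinarith

variable [DecidableEq ι]

/-- Cayley–Hamilton, as an expression of the power `n = card ι` through lower ones. -/
lemma exists_pow_card_eq_sum [Nonempty ι] (A : Matrix ι ι ℝ) :
    ∃ c : ℕ → ℝ, A ^ Fintype.card ι = ∑ j ∈ range (Fintype.card ι), c j • A ^ j := by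
  have hdeg : (Polynomial.X ^ Fintype.card ι %ₘ A.charpoly).natDegree < Fintype.card ι := by
    have := Polynomial.natDegree_modByMonic_lt (Polynomial.X ^ Fintype.card ι)
      A.charpoly_monic (fun h => by
        have := A.charpoly_natDegree_eq_dim
        rw [h, Polynomial.natDegree_one] at this
        exact Fintype.card_ne_zero this.symm)
    rwa [A.charpoly_natDegree_eq_dim] at this
  exact ⟨_, (A.pow_eq_aeval_mod_charpoly _).trans (Polynomial.aeval_eq_sum_range' hdeg A)⟩

/-- A single summand of the time derivative of the corrector, with `u` and `y` standing for
`U` and `∂ₓU`. -/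
lemma corrector_term_le (A B : Matrix ι ι ℝ) {n : ℕ} {c : ℕ → ℝ}
    (hc : A ^ n = ∑ j ∈ range n, c j • A ^ j) {K δ s : ℝ} (hK1 : 1 ≤ K)
    (hKc : ∀ k < n, |c k| ≤ K) (hδ : 0 < δ) (hδ1 : δ ≤ 1) {e : ℕ → ℝ} (he0 : e 0 = 1)
    (hepos : ∀ k, 0 < e k) (hedec : ∀ j k, j < k → k < n → e k ≤ δ ^ 2 * e j)
    (hesq : ∀ k, k + 2 < n → e (k + 1) ^ 2 ≤ δ ^ 2 * (e k * e (k + 2))) {u : ι → ℝ}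
    (hBu : ∀ k < n, (B * A ^ k) *ᵥ (B *ᵥ u) ⬝ᵥ (B * A ^ k) *ᵥ (B *ᵥ u) ≤ K * s)
    (y : ι → ℝ) {k : ℕ} (hk : k ∈ Ico 1 n) :
    e k * ((B * A ^ (k - 1)) *ᵥ (-(A *ᵥ y) - B *ᵥ u) ⬝ᵥ (B * A ^ k) *ᵥ y
        - (B * A ^ (k - 1)) *ᵥ y ⬝ᵥ (B * A ^ k) *ᵥ (-(A *ᵥ y) - B *ᵥ u))
      ≤ -(e k * ((B * A ^ k) *ᵥ y ⬝ᵥ (B * A ^ k) *ᵥ y))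
        + δ * ((2 + n * K) * (∑ k ∈ range n, e k * ((B * A ^ k) *ᵥ y ⬝ᵥ (B * A ^ k) *ᵥ y))
          + K * s) := by
  set v : ℕ → ι → ℝ := fun k => (B * A ^ k) *ᵥ y with hv
  set N : ℕ → ℝ := fun k => v k ⬝ᵥ v k with hN
  have hNnn (k) : 0 ≤ N k := dotProduct_self_nonneg _
  set S := ∑ k ∈ range n, e k * N k with hSdef
  have heN {k} (hk : k < n) : e k * N k ≤ S :=
    single_le_sum (f := fun k => e k * N k) (fun i _ => mul_nonneg (hepos i).le (hNnn i))
      (mem_range.2 hk)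
  have hSnn : 0 ≤ S := sum_nonneg fun i _ => mul_nonneg (hepos i).le (hNnn i)
  have hpair {j k l} {a b : ℝ} (hj : j < n) (hl : l < n) (ha : 0 ≤ a)
      (h : (e k * b) ^ 2 ≤ (δ * a) ^ 2 * (e j * e l)) :
      e k * b * (v j ⬝ᵥ v l) ≤ δ * a * S := by
    have h1 := mul_dotProduct_le (mul_nonneg hδ.le ha) (hepos j).le (hepos l).le h (v j) (v l)
    have h2 : δ * a / 2 * (e j * N j + e l * N l) ≤ δ * a / 2 * (S + S) := by
      gcongr
      exacts [heN hj, heN hl]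
    calc _ ≤ _ := h1
      _ ≤ _ := h2
      _ = _ := by ring
  obtain ⟨hk1, hkn⟩ := mem_Ico.1 hk
  obtain ⟨j, rfl⟩ := Nat.exists_eq_add_of_le' hk1
  have hjn : j < n := by omega
  have hstep (i : ℕ) (w : ι → ℝ) : (B * A ^ i) *ᵥ (A *ᵥ w) = (B * A ^ (i + 1)) *ᵥ w := by
    rw [mulVec_mulVec, Matrix.mul_assoc, ← pow_succ]
  have hedec' := hedec j (j + 1) (Nat.lt_succ_self j) hkn
  have he1 : e (j + 1) ≤ δ ^ 2 := by simpa [he0] using hedec 0 (j + 1) (by omega) hkn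
  have T₁ : e (j + 1) * (v j ⬝ᵥ v (j + 2)) ≤ δ * (1 + n * K) * S := by
    rcases Nat.lt_or_ge (j + 2) n with h | h
    · have := hpair (a := 1) (b := 1) (k := j + 1) hjn h zero_le_one (by simpa using hesq j h)
      have h' : 0 ≤ δ * (n * K) * S := by positivity
      linarith
    · have hj2 : j + 2 = n := by omega
      have hvn : v (j + 2) = ∑ i ∈ range n, c i • v i := by
        simp only [hv]
        rw [hj2, hc, mul_sum, sum_mulVec]
        simp [smul_mulVec]
      rw [hvn, dotProduct_sum, mul_sum]
      calc ∑ i ∈ range n, e (j + 1) * (v j ⬝ᵥ c i • v i)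
          ≤ ∑ i ∈ range n, δ * K * S := by
            refine sum_le_sum fun i hi => ?_
            have hi := mem_range.1 hi
            have hle : e (j + 1) ≤ e i := by
              rcases Nat.lt_or_ge i (j + 1) with h' | h'
              · refine (hedec i (j + 1) h' hkn).trans (mul_le_of_le_one_left (hepos i).le ?_)
                exact pow_le_one₀ hδ.le (hδ1)
              · rw [show i = j + 1 by omega]
            rw [dotProduct_smul, smul_eq_mul, ← mul_assoc]
            refine hpair hjn hi (by positivity) ?_
            have hcK : c i ^ 2 ≤ K ^ 2 := sq_le_sq' (by linarith [neg_abs_le (c i), hKc i hi])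
              ((le_abs_self _).trans (hKc i hi))
            calc (e (j + 1) * c i) ^ 2 = c i ^ 2 * (e (j + 1) * e (j + 1)) := by ring
              _ ≤ K ^ 2 * (δ ^ 2 * e j * e i) := by
                have := hepos (j + 1); have := hepos j
                gcongr
              _ = _ := by ring
        _ = δ * (n * K) * S := by simp; ring
        _ ≤ δ * (1 + n * K) * S := by gcongr; linarith
  have T₂ : -e (j + 1) * ((B * A ^ j) *ᵥ (B *ᵥ u) ⬝ᵥ v (j + 1)) ≤ δ / 2 * (K * s + S) := by
    have h := mul_dotProduct_le (e := -e (j + 1)) (p := 1) hδ.le zero_le_one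
      (hepos (j + 1)).le (by
        rw [neg_sq, sq, one_mul]; have := hepos (j + 1); gcongr)
      ((B * A ^ j) *ᵥ (B *ᵥ u)) (v (j + 1))
    refine h.trans ?_
    rw [one_mul]
    gcongr
    exacts [hBu j hjn, heN hkn]
  have T₃ : e (j + 1) * (v j ⬝ᵥ (B * A ^ (j + 1)) *ᵥ (B *ᵥ u)) ≤ δ / 2 * (S + K * s) := by
    have h := mul_dotProduct_le (e := e (j + 1)) (q := 1) hδ.le (hepos j).le zero_le_one (by
        have h1 : e (j + 1) ≤ 1 := he1.trans (pow_le_one₀ hδ.le (hδ1))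
        have := hepos (j + 1)
        nlinarith)
      (v j) ((B * A ^ (j + 1)) *ᵥ (B *ᵥ u))
    refine h.trans ?_
    rw [one_mul]
    gcongr
    exacts [heN hjn, hBu _ hkn]
  simp only [Nat.add_sub_cancel, mulVec_sub, mulVec_neg, hstep, sub_dotProduct, neg_dotProduct,
    dotProduct_sub, dotProduct_neg]
  simp only [hv] at T₁ T₂ T₃ ⊢
  linarith

/-- Absorption of the error terms of the corrector estimate. -/
lemma corrector_error_le {m n K δ ε₀ S S' r s : ℝ} (hm : 0 ≤ m) (hmn : m ≤ n) (hK : 1 ≤ K)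
    (hδ : 0 ≤ δ) (hδ1 : δ * (2 * n * ((3 + n * K) * K)) ≤ 1)
    (hδε : δ * (2 * n * ((3 + n * K) * K)) ≤ ε₀) (hS' : 0 ≤ S') (hr : 0 ≤ r) (hs : 0 ≤ s)
    (hS : S ≤ K * r + S') :
    m * (δ * ((2 + n * K) * S + K * s)) ≤ 1 / 2 * S' + ε₀ * s + ε₀ * r := by
  have hn : 0 ≤ n := hm.trans hmn
  have hK0 : 0 ≤ K := by linarith
  have hnK : 0 ≤ n * K := mul_nonneg hn hK0
  have h₁ : 2 + n * K ≤ (3 + n * K) * K :=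
    (by linarith : 2 + n * K ≤ 3 + n * K).trans (le_mul_of_one_le_right (by linarith) hK)
  have h₂ : K ≤ (3 + n * K) * K := le_mul_of_one_le_left hK0 (by linarith)
  have h₃ : (2 + n * K) * K ≤ (3 + n * K) * K := by gcongr; norm_num
  have hin : (2 + n * K) * S + K * s ≤ (3 + n * K) * K * (S' + r + s) := by
    calc (2 + n * K) * S + K * s ≤ (2 + n * K) * (K * r + S') + K * s := by gcongr
      _ = (2 + n * K) * S' + (2 + n * K) * K * r + K * s := by ring
      _ ≤ (3 + n * K) * K * S' + (3 + n * K) * K * r + (3 + n * K) * K * s := by gcongr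
      _ = _ := by ring
  set C := 2 * n * ((3 + n * K) * K) with hC
  have hC0 : 0 ≤ C := by positivity
  calc m * (δ * ((2 + n * K) * S + K * s))
      ≤ m * (δ * ((3 + n * K) * K * (S' + r + s))) := by gcongr
    _ ≤ n * (δ * ((3 + n * K) * K * (S' + r + s))) := by gcongr
    _ = 1 / 2 * (δ * C * S' + δ * C * s + δ * C * r) := by rw [hC]; ring
    _ ≤ 1 / 2 * (1 * S' + ε₀ * s + ε₀ * r) := by gcongr
    _ ≤ _ := by
      have hε₀ : 0 ≤ ε₀ := (mul_nonneg hδ hC0).trans hδε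
      linarith [mul_nonneg hε₀ hs, mul_nonneg hε₀ hr]

/-- Pointwise form of the corrector estimate, with `u` and `y` standing for `U` and `∂ₓU`. -/
lemma exists_corrector_weights [Nonempty ι] (A B P : Matrix ι ι ℝ) (hBP : B * P = B)
    {ε₀ : ℝ} (hε₀ : 0 < ε₀) :
    ∃ ε : ℕ → ℝ, (∀ k, 0 < ε k) ∧ ∀ u y : ι → ℝ,
      ∑ k ∈ Ico 1 (Fintype.card ι), ε k *
          ((B * A ^ (k - 1)) *ᵥ (-(A *ᵥ y) - B *ᵥ u) ⬝ᵥ (B * A ^ k) *ᵥ y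
            - (B * A ^ (k - 1)) *ᵥ y ⬝ᵥ (B * A ^ k) *ᵥ (-(A *ᵥ y) - B *ᵥ u))
        + 1 / 2 * ∑ k ∈ Ico 1 (Fintype.card ι), ε k * ((B * A ^ k) *ᵥ y ⬝ᵥ (B * A ^ k) *ᵥ y)
      ≤ ε₀ * (P *ᵥ u ⬝ᵥ P *ᵥ u) + ε₀ * (P *ᵥ y ⬝ᵥ P *ᵥ y) := by
  obtain ⟨c, hc⟩ := exists_pow_card_eq_sum A
  set n := Fintype.card ι
  have hn0 : 0 < n := Fintype.card_pos
  set frob : Matrix ι ι ℝ → ℝ := fun M => ∑ i, ∑ j, M i j ^ 2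
  have frob_nonneg (M) : 0 ≤ frob M := by positivity
  set K : ℝ := 1 + frob B + ∑ k ∈ range n, |c k| + ∑ k ∈ range n, frob (B * A ^ k * B)
  have hS₁ : 0 ≤ ∑ k ∈ range n, |c k| := by positivity
  have hS₂ : 0 ≤ ∑ k ∈ range n, frob (B * A ^ k * B) := sum_nonneg fun k _ => frob_nonneg _
  have hK1 : 1 ≤ K := by linarith [frob_nonneg B]
  have hKB : frob B ≤ K := by linarith
  have hKc {k} (hk : k < n) : |c k| ≤ K := by
    have := single_le_sum (f := fun k => |c k|) (fun i _ => abs_nonneg _) (mem_range.2 hk)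
    linarith [frob_nonneg B]
  have hKM {k} (hk : k < n) : frob (B * A ^ k * B) ≤ K := by
    have := single_le_sum (f := fun k => frob (B * A ^ k * B)) (fun i _ => frob_nonneg _)
      (mem_range.2 hk)
    linarith [frob_nonneg B]
  have hBu {k} (hk : k < n) (u : ι → ℝ) :
      (B * A ^ k) *ᵥ (B *ᵥ u) ⬝ᵥ (B * A ^ k) *ᵥ (B *ᵥ u) ≤ K * (P *ᵥ u ⬝ᵥ P *ᵥ u) := by
    have h := dotProduct_mulVec_self_le (B * A ^ k * B) (P *ᵥ u)
    rw [mulVec_mulVec, Matrix.mul_assoc (B * A ^ k), hBP, ← mulVec_mulVec] at h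
    exact h.trans (by gcongr; exacts [dotProduct_self_nonneg _, hKM hk])
  have hBy (y : ι → ℝ) : B *ᵥ y ⬝ᵥ B *ᵥ y ≤ K * (P *ᵥ y ⬝ᵥ P *ᵥ y) := by
    have h := dotProduct_mulVec_self_le B (P *ᵥ y)
    rw [mulVec_mulVec, hBP] at h
    exact h.trans (by gcongr; exact dotProduct_self_nonneg _)
  set C : ℝ := 2 * n * ((3 + n * K) * K)
  have hn' : (0 : ℝ) < n := by exact_mod_cast hn0
  have hC : 0 < C := by positivity
  set δ : ℝ := min 1 (min 1 ε₀ / C)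
  have hδ : 0 < δ := by positivity
  have hδC : δ * C ≤ min 1 ε₀ := by
    rw [← le_div_iff₀ hC]; exact min_le_right _ _
  obtain ⟨e, he0, hepos, hedec, hesq⟩ := exists_weights n hδ (min_le_left _ _)
  refine ⟨e, hepos, fun u y => ?_⟩
  have hsum := sum_le_sum fun k (hk : k ∈ Ico 1 n) => corrector_term_le A B hc hK1
    (fun k hk => hKc hk) hδ (min_le_left _ _) he0 hepos hedec hesq (fun k hk => hBu hk u) y hk
  set N : ℕ → ℝ := fun k => (B * A ^ k) *ᵥ y ⬝ᵥ (B * A ^ k) *ᵥ y with hN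
  have hNnn (k) : 0 ≤ N k := dotProduct_self_nonneg _
  set s := P *ᵥ u ⬝ᵥ P *ᵥ u
  set S := ∑ k ∈ range n, e k * N k with hSdef
  rw [sum_add_distrib, sum_neg_distrib, sum_const, Nat.card_Ico, nsmul_eq_mul] at hsum
  set S' := ∑ k ∈ Ico 1 n, e k * N k
  have hS0 : S = N 0 + S' := by
    rw [hSdef, range_eq_Ico, sum_eq_sum_Ico_succ_bot hn0, he0, one_mul]
  have hN0 : N 0 ≤ K * (P *ᵥ y ⬝ᵥ P *ᵥ y) := by simpa [hN] using hBy y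
  have hS'nn : 0 ≤ S' := sum_nonneg fun i _ => mul_nonneg (hepos i).le (hNnn i)
  set r := P *ᵥ y ⬝ᵥ P *ᵥ y
  have herr := corrector_error_le (Nat.cast_nonneg (n - 1))
    (by exact_mod_cast Nat.sub_le n 1 : ((n - 1 : ℕ) : ℝ) ≤ n) hK1 hδ.le
    (hδC.trans (min_le_left _ _)) (hδC.trans (min_le_right _ _)) hS'nn
    (dotProduct_self_nonneg (P *ᵥ y)) (dotProduct_self_nonneg (P *ᵥ u))
    (by linarith : S ≤ K * r + S')
  change _ + 1 / 2 * S' ≤ _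
  linarith

end Algebra

/-- The bilinear form `(v, w) ↦ ⟨M v, N w⟩`. -/
def gramForm {ι : Type*} [Fintype ι] (M N : Matrix ι ι ℝ) : (ι → ℝ) →L[ℝ] (ι → ℝ) →L[ℝ] ℝ :=
  (LinearMap.mk₂ ℝ (fun v w => M *ᵥ v ⬝ᵥ N *ᵥ w)
    (fun _ _ _ => by rw [mulVec_add, add_dotProduct])
    (fun _ _ _ => by rw [mulVec_smul, smul_dotProduct])
    (fun _ _ _ => by rw [mulVec_add, dotProduct_add])
    (fun _ _ _ => by rw [mulVec_smul, dotProduct_smul])).toContinuousBilinearMap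

lemma gramForm_apply {ι : Type*} [Fintype ι] (M N : Matrix ι ι ℝ) (v w : ι → ℝ) :
    gramForm M N v w = M *ᵥ v ⬝ᵥ N *ᵥ w := rfl

lemma IsClassicalSolution.spaceDecay {n₁ n₂ : ℕ} {A : Matrix (Idx n₁ n₂) (Idx n₁ n₂) ℝ}
    {D : Matrix (Fin n₂) (Fin n₂) ℝ} {U : ℝ → ℝ → Idx n₁ n₂ → ℝ}
    (h : IsClassicalSolution A D U) : SpaceDecay U := by
  intro m T
  obtain ⟨C₀, h₀⟩ := h.decay 0 m T
  obtain ⟨C₂, h₂⟩ := h.decay 2 m T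
  refine ⟨C₀ + C₂, fun t ht x => ?_⟩
  rw [← div_eq_mul_inv, le_div_iff₀ (by positivity)]
  have h₀ := h₀ t ht x
  have h₂ := h₂ t ht x
  rw [sq_abs] at h₂
  rw [pow_zero, one_mul] at h₀
  linarith

lemma Bmat_one_gram {n₁ n₂ : ℕ} (v : Idx n₁ n₂ → ℝ) :
    Bmat (1 : Matrix (Fin n₂) (Fin n₂) ℝ) *ᵥ v ⬝ᵥ Bmat (1 : Matrix (Fin n₂) (Fin n₂) ℝ) *ᵥ v
      = ∑ j, v (Sum.inr j) ^ 2 := by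
  simp [Bmat, fromBlocks_mulVec, dotProduct, Fintype.sum_sum_type, sq]

/-- **Lemma 3.1.** For any `ε₀ > 0` there are small positive `ε₁,…,ε_{n−1}`
(depending only on `ε₀, n, A, B`) such that, along every classical solution,
`(d/dt)𝓘(t) + ½ ∑_{k=1}^{n−1} ε_k ‖BA^k ∂ₓU(t)‖²_{L²} ≤ ε₀‖U₂(t)‖²_{L²} + ε₀‖∂ₓU₂(t)‖²_{L²}`
for all `t > 0`. -/
theorem corrector_estimate
    {n₁ n₂ : ℕ} (hn₁ : 1 ≤ n₁) (hn₂ : 1 ≤ n₂)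
    (A : Matrix (Idx n₁ n₂) (Idx n₁ n₂) ℝ) (hA : A.IsSymm)
    (D : Matrix (Fin n₂) (Fin n₂) ℝ) (hD : D.IsSymm) (hDpos : D.PosDef)
    (κ : ℝ) (hκ : 0 < κ)
    (hdiss : ∀ X : Fin n₂ → ℝ, κ * ∑ j, (X j) ^ 2 ≤ ∑ j, D.mulVec X j * X j)
    (ε₀ : ℝ) (hε₀ : 0 < ε₀) :
    ∃ ε : ℕ → ℝ, (∀ k ∈ Finset.Ico 1 (n₁ + n₂), 0 < ε k) ∧
      ∀ U : ℝ → ℝ → Idx n₁ n₂ → ℝ, IsClassicalSolution A D U →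
        ∀ t : ℝ, 0 < t → ∃ d : ℝ,
          HasDerivAt (corrector A D ε U) d t ∧
          d + (1 / 2 : ℝ) * ∑ k ∈ Finset.Ico 1 (n₁ + n₂),
              ε k * sqL2 (fun x => (Bmat D * A ^ k).mulVec (pdx U t x)) ≤
            ε₀ * sqL2 (U2part U t) + ε₀ * sqL2 (fun x j => pdx U t x (Sum.inr j)) := by
  have hcard : Fintype.card (Idx n₁ n₂) = n₁ + n₂ := by simp
  have : Nonempty (Idx n₁ n₂) := ⟨Sum.inl ⟨0, hn₁⟩⟩
  set B : Matrix (Idx n₁ n₂) (Idx n₁ n₂) ℝ := Bmat D with hB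
  set P : Matrix (Idx n₁ n₂) (Idx n₁ n₂) ℝ := Bmat 1 with hP
  have hBP : B * P = B := by simp [hB, hP, Bmat, fromBlocks_multiply]
  obtain ⟨ε, hεpos, hε⟩ := exists_corrector_weights A B P hBP hε₀
  rw [hcard] at hε
  refine ⟨ε, fun k _ => hεpos k, fun U hU t ht => ?_⟩
  have hd := hU.spaceDecay
  set u : ℝ → Idx n₁ n₂ → ℝ := U t
  set y : ℝ → Idx n₁ n₂ → ℝ := pdx U t
  have cu : Continuous u := hU.smooth.continuous.comp (Continuous.prodMk_right t)
  have cy : Continuous y := (contDiff_pdx hU.smooth).continuous.comp (Continuous.prodMk_right t)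
  have du : ∃ C, ∀ x, ‖u x‖ ≤ C * (1 + x ^ 2)⁻¹ :=
    (hd.bound t).imp fun C h x => h t ⟨ht.le, le_rfl⟩ x
  have dy : ∃ C, ∀ x, ‖y x‖ ≤ C * (1 + x ^ 2)⁻¹ :=
    (hd.pdx.bound t).imp fun C h x => h t ⟨ht.le, le_rfl⟩ x
  have igram {f : ℝ → Idx n₁ n₂ → ℝ} (cf : Continuous f)
      (df : ∃ C, ∀ x, ‖f x‖ ≤ C * (1 + x ^ 2)⁻¹) (M : Matrix (Idx n₁ n₂) (Idx n₁ n₂) ℝ) :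
      Integrable (fun x => M *ᵥ f x ⬝ᵥ M *ᵥ f x) :=
    integrable_bilinear_of_decay (gramForm M M) cf cf df df
  set R : ℕ → ℝ → ℝ := fun k x =>
    (B * A ^ (k - 1)) *ᵥ (-(A *ᵥ y x) - B *ᵥ u x) ⬝ᵥ (B * A ^ k) *ᵥ y x
      - (B * A ^ (k - 1)) *ᵥ y x ⬝ᵥ (B * A ^ k) *ᵥ (-(A *ᵥ y x) - B *ᵥ u x)
  have hder (k : ℕ) : Integrable (R k) ∧
      HasDerivAt (fun s => ∫ x, (B * A ^ (k - 1)) *ᵥ U s x ⬝ᵥ (B * A ^ k) *ᵥ pdx U s x)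
        (∫ x, R k x) t := by
    have h := hasDerivAt_integral_bilinear_pdx hU.smooth hd
      (-(toLin' A).toContinuousLinearMap) (-(toLin' B).toContinuousLinearMap)
      (fun t x ht => by
        have := hU.eqn t x ht
        rw [add_assoc, add_eq_zero_iff_eq_neg, neg_add] at this
        simpa using this)
      (gramForm (B * A ^ (k - 1)) (B * A ^ k)) ht
    simpa only [gramForm_apply, _root_.neg_apply,
      LinearMap.coe_toContinuousLinearMap', toLin'_apply, ← sub_eq_add_neg] using h
  refine ⟨∑ k ∈ Ico 1 (n₁ + n₂), ε k * ∫ x, R k x,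
    HasDerivAt.fun_sum fun k _ => (hder k).2.const_mul (ε k), ?_⟩
  have hN (k : ℕ) : sqL2 (fun x => (B * A ^ k) *ᵥ y x)
      = ∫ x, (B * A ^ k) *ᵥ y x ⬝ᵥ (B * A ^ k) *ᵥ y x := by
    simp only [sqL2, dotProduct, sq]
  have hu2 : sqL2 (U2part U t) = ∫ x, P *ᵥ u x ⬝ᵥ P *ᵥ u x := by
    simp only [hP, Bmat_one_gram, sqL2, U2part, u]
  have hy2 : sqL2 (fun x j => y x (Sum.inr j)) = ∫ x, P *ᵥ y x ⬝ᵥ P *ᵥ y x := by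
    simp only [hP, Bmat_one_gram, sqL2]
  have iR : Integrable (fun x => ∑ k ∈ Ico 1 (n₁ + n₂), ε k * R k x) :=
    integrable_finsetSum _ fun k _ => (hder k).1.const_mul (ε k)
  have iN : Integrable (fun x => 1 / 2 * ∑ k ∈ Ico 1 (n₁ + n₂),
      ε k * ((B * A ^ k) *ᵥ y x ⬝ᵥ (B * A ^ k) *ᵥ y x)) :=
    (integrable_finsetSum _ fun k _ => (igram cy dy _).const_mul (ε k)).const_mul _
  have hmono := integral_mono (iR.add iN)
    (((igram cu du P).const_mul ε₀).add ((igram cy dy P).const_mul ε₀))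
    (fun x => hε (u x) (y x))
  simp only [Pi.add_apply] at hmono
  rw [integral_add iR iN, integral_add ((igram cu du P).const_mul ε₀)
    ((igram cy dy P).const_mul ε₀), integral_const_mul, integral_const_mul, integral_const_mul,
    integral_finsetSum _ fun k _ => (hder k).1.const_mul (ε k),
    integral_finsetSum _ fun k _ => (igram cy dy _).const_mul (ε k)] at hmono
  simpa only [integral_const_mul, hN, hu2, hy2] using hmono
end
end

section
/- Hypocoercive Lyapunov functional in physical space: Assume (A,B) satisfies the Kalman rank condition. Then there exist positive constants η₀, ε₁, …, ε_{n−1}, c₀, c₁, c₂ (depending only on n, A, B, κ) such that for every classical solution U of the linear partially dissipative system, the functional 𝓛(t) := ‖U(t)‖²_{H¹} + η₀ t ‖∂ₓU(t)‖²_{L²} + Σ_{k=1}^{n−1} ε_k ⟨BA^{k−1}U(t), BA^k ∂ₓU(t)⟩_{L²} satisfies c₀(‖U(t)‖²_{H¹} + η₀ t‖∂ₓU(t)‖²_{L²}) ≤ 𝓛(t) ≤ c₁(‖U(t)‖²_{H¹} + η₀ t‖∂ₓU(t)‖²_{L²}) for all t ≥ 0, and the differential inequality (d/dt)𝓛(t)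 + (κ/2)‖U₂(t)‖²_{L²} + κ(½ + η₀ t)‖∂ₓU₂(t)‖²_{L²} + c₂‖∂ₓU(t)‖²_{L²} ≤ 0 holds for all t > 0. -/
open MeasureTheory Matrix Finset

noncomputable section

/-- The time-weighted hypocoercive Lyapunov functional
`𝓛(t) = ‖U(t)‖²_{H¹} + η₀ t ‖∂ₓU(t)‖²_{L²} + ∑ ε_k ⟨BA^{k−1}U, BA^k ∂ₓU⟩_{L²}`. -/
def lyapunov {n₁ n₂ : ℕ} (A : Matrix (Idx n₁ n₂) (Idx n₁ n₂) ℝ)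
    (D : Matrix (Fin n₂) (Fin n₂) ℝ) (η₀ : ℝ) (ε : ℕ → ℝ)
    (U : ℝ → ℝ → Idx n₁ n₂ → ℝ) (t : ℝ) : ℝ :=
  sqH1 (U t) + η₀ * t * sqL2 (fun x => pdx U t x) + corrector A D ε U t


section Algebra

variable {ι ι' : Type*} [Fintype ι] [Fintype ι']

lemma zero_le_dotProduct_self (p : ι → ℝ) : 0 ≤ p ⬝ᵥ p :=
  Finset.sum_nonneg fun _ _ => mul_self_nonneg _

lemma mul_abs_dotProduct_le {e s r : ℝ} (hs : 0 ≤ s) (hr : 0 ≤ r)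
    (h : e ^ 2 = s * r) (p q : ι → ℝ) :
    e * |p ⬝ᵥ q| ≤ (s * (p ⬝ᵥ p) + r * (q ⬝ᵥ q)) / 2 := by
  have hpq : (p ⬝ᵥ q) ^ 2 ≤ (p ⬝ᵥ p) * (q ⬝ᵥ q) := by
    simpa [dotProduct, sq] using Finset.sum_mul_sq_le_sq_mul_sq univ p q
  have hp : 0 ≤ p ⬝ᵥ p := zero_le_dotProduct_self p
  have hq : 0 ≤ q ⬝ᵥ q := zero_le_dotProduct_self q
  refine abs_le_of_sq_le_sq' ?_ (by positivity) |>.2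
  rw [mul_pow, sq_abs, h]
  nlinarith [mul_le_mul_of_nonneg_left hpq (mul_nonneg hs hr),
    sq_nonneg (s * (p ⬝ᵥ p) - r * (q ⬝ᵥ q))]

lemma exists_mulVec_dotProduct_self_le (P : Matrix ι' ι ℝ) :
    ∃ M : ℝ, 0 ≤ M ∧ ∀ w : ι → ℝ, (P *ᵥ w) ⬝ᵥ (P *ᵥ w) ≤ M * (w ⬝ᵥ w) := by
  refine ⟨∑ i, ∑ j, P i j ^ 2, by positivity, fun w => ?_⟩
  rw [Finset.sum_mul]
  refine Finset.sum_le_sum fun i _ => ?_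
  have := Finset.sum_mul_sq_le_sq_mul_sq univ (P i) w
  simpa [dotProduct, mulVec, sq] using this

lemma exists_uniform_mulVec_dotProduct_self_le {κ : Type*} (s : Finset κ)
    (P : κ → Matrix ι' ι ℝ) :
    ∃ M : ℝ, 0 ≤ M ∧ ∀ k ∈ s, ∀ w : ι → ℝ,
      (P k *ᵥ w) ⬝ᵥ (P k *ᵥ w) ≤ M * (w ⬝ᵥ w) := by
  choose M hM h using fun k => exists_mulVec_dotProduct_self_le (P k)
  refine ⟨∑ k ∈ s, M k, Finset.sum_nonneg fun k _ => hM k, fun k hk w => (h k w).trans ?_⟩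
  exact mul_le_mul_of_nonneg_right (Finset.single_le_sum (fun k _ => hM k) hk)
    (zero_le_dotProduct_self w)

lemma exists_dotProduct_self_le_sum {N : ℕ} (P : Fin N → Matrix ι ι ℝ)
    (h : ∀ y : ι → ℝ, (∀ k, P k *ᵥ y = 0) → y = 0) :
    ∃ K : ℝ, 0 ≤ K ∧ ∀ v : ι → ℝ, v ⬝ᵥ v ≤ K * ∑ k, (P k *ᵥ v) ⬝ᵥ (P k *ᵥ v) := by
  classical
  let L : (ι → ℝ) →ₗ[ℝ] (Fin N → ι → ℝ) := LinearMap.pi fun k => (P k).mulVecLin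
  have hL : L.ker = ⊥ := by
    refine LinearMap.ker_eq_bot'.2 fun y hy => h y fun k => ?_
    exact congrFun hy k
  obtain ⟨K, -, hK⟩ := L.exists_antilipschitzWith hL
  have hsq : ∀ w : ι → ℝ, ‖w‖ ^ 2 ≤ w ⬝ᵥ w := fun w => by
    have h0 : 0 ≤ w ⬝ᵥ w := zero_le_dotProduct_self w
    have : ‖w‖ ≤ √(w ⬝ᵥ w) := by
      refine (pi_norm_le_iff_of_nonneg (Real.sqrt_nonneg _)).2 fun i => ?_
      refine Real.abs_le_sqrt ?_
      rw [sq]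
      exact Finset.single_le_sum (f := fun i => w i * w i)
        (fun i _ => mul_self_nonneg _) (Finset.mem_univ i)
    calc ‖w‖ ^ 2 ≤ √(w ⬝ᵥ w) ^ 2 := by gcongr
      _ = _ := Real.sq_sqrt h0
  have hS : ∀ v, 0 ≤ ∑ k, (P k *ᵥ v) ⬝ᵥ (P k *ᵥ v) := fun v =>
    Finset.sum_nonneg fun k _ => zero_le_dotProduct_self _
  refine ⟨Fintype.card ι * (K : ℝ) ^ 2, by positivity, fun v => ?_⟩
  have h1 : v ⬝ᵥ v ≤ Fintype.card ι * ‖v‖ ^ 2 := by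
    calc v ⬝ᵥ v ≤ ∑ _i : ι, ‖v‖ ^ 2 := Finset.sum_le_sum fun i _ => by
          have := norm_le_pi_norm v i
          rw [Real.norm_eq_abs] at this
          nlinarith [abs_mul_abs_self (v i), abs_nonneg (v i)]
      _ = _ := by simp
  have h2 : ‖v‖ ≤ K * ‖L v‖ := by
    simpa using hK.le_mul_dist v 0
  have h3 : ‖L v‖ ≤ √(∑ k, (P k *ᵥ v) ⬝ᵥ (P k *ᵥ v)) := by
    refine (pi_norm_le_iff_of_nonneg (Real.sqrt_nonneg _)).2 fun k => ?_
    refine Real.le_sqrt_of_sq_le ((hsq _).trans ?_)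
    exact Finset.single_le_sum (f := fun k => (P k *ᵥ v) ⬝ᵥ (P k *ᵥ v))
      (fun k _ => zero_le_dotProduct_self _) (Finset.mem_univ k)
  have h4 : ‖v‖ ^ 2 ≤ (K : ℝ) ^ 2 * ∑ k, (P k *ᵥ v) ⬝ᵥ (P k *ᵥ v) := by
    calc ‖v‖ ^ 2 ≤ (K * √(∑ k, (P k *ᵥ v) ⬝ᵥ (P k *ᵥ v))) ^ 2 := by
          gcongr; exact h2.trans (by gcongr)
      _ = _ := by rw [mul_pow, Real.sq_sqrt (hS v)]
  calc v ⬝ᵥ v ≤ _ := h1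
    _ ≤ _ := by rw [mul_assoc]; gcongr

/-- Geometric weights whose exponents are strictly concave and increasing up to index `m + 1`. -/
def concaveWeight (m : ℕ) (δ : ℝ) (k : ℕ) : ℝ := δ ^ (k * (2 * m + 4 - k))

lemma concaveWeight_pos {m : ℕ} {δ : ℝ} (hδ : 0 < δ) (k : ℕ) : 0 < concaveWeight m δ k :=
  pow_pos hδ _

lemma concaveWeight_zero (m : ℕ) (δ : ℝ) : concaveWeight m δ 0 = 1 := by
  simp [concaveWeight]

lemma concaveWeight_le_one {m : ℕ} {δ : ℝ} (hδ : 0 < δ) (h1 : δ ≤ 1) (k : ℕ) :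
    concaveWeight m δ k ≤ 1 := pow_le_one₀ hδ.le h1

lemma concaveWeight_le {m : ℕ} {δ : ℝ} (hδ : 0 < δ) (h1 : δ ≤ 1) {k : ℕ} (hk : 1 ≤ k)
    (hk' : k ≤ m + 1) : concaveWeight m δ k ≤ δ := by
  refine pow_le_of_le_one hδ.le h1 (Nat.mul_ne_zero (by omega) (by omega))

lemma concaveWeight_last_le {m : ℕ} {δ : ℝ} (hδ : 0 < δ) (h1 : δ ≤ 1) {k : ℕ}
    (hk : k ≤ m + 1) : concaveWeight m δ (m + 1) ≤ concaveWeight m δ k := by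
  refine pow_le_pow_of_le_one hδ.le h1 ?_
  obtain ⟨r, hr⟩ := Nat.exists_eq_add_of_le hk
  obtain rfl | ⟨j, rfl⟩ : k = 0 ∨ ∃ j, k = j + 1 := by
    cases k <;> simp
  · simp
  obtain rfl : m = j + r := by omega
  rw [show 2 * (j + r) + 4 - (j + 1) = j + 2 * r + 3 by omega,
    show 2 * (j + r) + 4 - (j + r + 1) = j + r + 3 by omega]
  nlinarith

lemma concaveWeight_sq {m : ℕ} (δ : ℝ) {i : ℕ} (hi : i < m) :
    concaveWeight m δ (i + 1) ^ 2
      = (δ * concaveWeight m δ i) * (δ * concaveWeight m δ (i + 2)) := by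
  obtain ⟨r, rfl⟩ := Nat.exists_eq_add_of_lt hi
  simp only [concaveWeight]
  rw [show 2 * (i + r + 1) + 4 - (i + 1) = i + 2 * r + 5 by omega,
    show 2 * (i + r + 1) + 4 - i = i + 2 * r + 6 by omega,
    show 2 * (i + r + 1) + 4 - (i + 2) = i + 2 * r + 4 by omega]
  rw [← pow_succ', ← pow_succ', ← pow_add, ← pow_mul]
  congr 1
  ring

lemma sum_range_le_of_neighbour_bound (m : ℕ) (y τ : ℕ → ℝ) (hy : ∀ i, 0 ≤ y i) {δ c : ℝ}
    (hδ : 0 ≤ δ)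
    (h : ∀ i < m, τ i ≤ -(3 / 4) * y (i + 1) + δ * y i + δ / 2 * y (i + 2) + c) :
    ∑ i ∈ range m, τ i ≤ -(3 / 4) * ∑ i ∈ range m, y (i + 1)
      + 3 / 2 * δ * (y 0 + ∑ i ∈ range m, y (i + 1) + y (m + 1)) + m * c := by
  have h1 : ∑ i ∈ range m, y i ≤ y 0 + ∑ i ∈ range m, y (i + 1) + y (m + 1) := by
    have := Finset.sum_range_succ' y m
    rw [Finset.sum_range_succ] at this
    linarith [hy m, hy (m + 1)]
  have h2 : ∑ i ∈ range m, y (i + 2) ≤ y 0 + ∑ i ∈ range m, y (i + 1) + y (m + 1) := by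
    have := Finset.sum_range_succ' (fun i => y (i + 1)) m
    rw [Finset.sum_range_succ] at this
    linarith [hy 0, hy 1]
  have h3 := Finset.sum_le_sum fun i hi => h i (Finset.mem_range.1 hi)
  simp only [Finset.sum_add_distrib, ← Finset.mul_sum, Finset.sum_const, Finset.card_range,
    nsmul_eq_mul] at h3
  nlinarith [mul_le_mul_of_nonneg_left h1 hδ, mul_le_mul_of_nonneg_left h2 hδ]

lemma exists_pos_le_one_mul_le (Q : ℝ) (hQ : 0 ≤ Q) {c : ℝ} (hc : 0 < c) :
    ∃ δ : ℝ, 0 < δ ∧ δ ≤ 1 ∧ δ * Q ≤ c := by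
  refine ⟨min 1 (c / (Q + 1)), by positivity, min_le_left _ _, ?_⟩
  calc min 1 (c / (Q + 1)) * Q ≤ c / (Q + 1) * (Q + 1) := by
        gcongr
        · exact min_le_right _ _
        · linarith
    _ = c := by field_simp

end Algebra

section Coefficients

variable {n₁ n₂ : ℕ}

/-- The squared Euclidean length of the second block of a vector. -/
def sndSq (u : Idx n₁ n₂ → ℝ) : ℝ := ∑ j, u (Sum.inr j) ^ 2

lemma sndSq_nonneg (u : Idx n₁ n₂ → ℝ) : 0 ≤ sndSq u :=
  Finset.sum_nonneg fun _ _ => sq_nonneg _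

/-- The projection onto the second block. -/
def sndProj : Matrix (Idx n₁ n₂) (Idx n₁ n₂) ℝ := Matrix.fromBlocks 0 0 0 1

lemma Bmat_mul_sndProj (D : Matrix (Fin n₂) (Fin n₂) ℝ) :
    (Bmat D : Matrix (Idx n₁ n₂) (Idx n₁ n₂) ℝ) * sndProj = Bmat D := by
  simp [Bmat, sndProj, Matrix.fromBlocks_multiply]

lemma sndProj_mulVec_dotProduct_self (u : Idx n₁ n₂ → ℝ) :
    (sndProj *ᵥ u) ⬝ᵥ (sndProj *ᵥ u) = sndSq u := by
  simp [sndProj, sndSq, Matrix.fromBlocks_mulVec, dotProduct, Function.comp_def, sq]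

lemma dotProduct_Bmat_mulVec (D : Matrix (Fin n₂) (Fin n₂) ℝ) (u : Idx n₁ n₂ → ℝ) :
    u ⬝ᵥ (Bmat D *ᵥ u) = ∑ j, D.mulVec (fun j => u (Sum.inr j)) j * u (Sum.inr j) := by
  simp [Bmat, Matrix.fromBlocks_mulVec, dotProduct, Function.comp_def, mul_comm]

/-- The density of the time derivative of the `k`-th corrector, after integration by parts. -/
def correctorRate (A : Matrix (Idx n₁ n₂) (Idx n₁ n₂) ℝ) (D : Matrix (Fin n₂) (Fin n₂) ℝ)
    (k : ℕ) (u v : Idx n₁ n₂ → ℝ) : ℝ :=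
  ((Bmat D * A ^ (k - 1)) *ᵥ v) ⬝ᵥ ((Bmat D * A ^ k) *ᵥ (A *ᵥ v + Bmat D *ᵥ u))
    - ((Bmat D * A ^ (k - 1)) *ᵥ (A *ᵥ v + Bmat D *ᵥ u)) ⬝ᵥ ((Bmat D * A ^ k) *ᵥ v)

lemma correctorRate_succ (A : Matrix (Idx n₁ n₂) (Idx n₁ n₂) ℝ)
    (D : Matrix (Fin n₂) (Fin n₂) ℝ) (i : ℕ) (u v : Idx n₁ n₂ → ℝ) :
    correctorRate A D (i + 1) u v =
      -(((Bmat D * A ^ (i + 1)) *ᵥ v) ⬝ᵥ ((Bmat D * A ^ (i + 1)) *ᵥ v))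
      - ((Bmat D * A ^ i * Bmat D) *ᵥ u) ⬝ᵥ ((Bmat D * A ^ (i + 1)) *ᵥ v)
      + ((Bmat D * A ^ i) *ᵥ v) ⬝ᵥ ((Bmat D * A ^ (i + 2)) *ᵥ v)
      + ((Bmat D * A ^ i) *ᵥ v) ⬝ᵥ ((Bmat D * A ^ (i + 1) * Bmat D) *ᵥ u) := by
  simp only [correctorRate, Nat.add_sub_cancel, Matrix.mulVec_add, Matrix.mulVec_mulVec,
    dotProduct_add, add_dotProduct, Matrix.mul_assoc, ← pow_succ]
  ring

lemma mul_correctorRate_succ_le (A : Matrix (Idx n₁ n₂) (Idx n₁ n₂) ℝ)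
    (D : Matrix (Fin n₂) (Fin n₂) ℝ) {i : ℕ} {δ e₀ e₁ e₂ M : ℝ} (hδ : 0 ≤ δ) (he₀ : 0 ≤ e₀)
    (he₁ : 0 ≤ e₁) (he₂ : 0 ≤ e₂) (hsq : e₁ ^ 2 = (δ * e₀) * (δ * e₂)) (he₁δ : e₁ ≤ δ)
    (he₂1 : e₂ ≤ 1) (hM : 0 ≤ M) {u : Idx n₁ n₂ → ℝ}
    (h₁ : ((Bmat D * A ^ i * Bmat D) *ᵥ u) ⬝ᵥ ((Bmat D * A ^ i * Bmat D) *ᵥ u)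
      ≤ M * sndSq u)
    (h₂ : ((Bmat D * A ^ (i + 1) * Bmat D) *ᵥ u) ⬝ᵥ ((Bmat D * A ^ (i + 1) * Bmat D) *ᵥ u)
      ≤ M * sndSq u) (v : Idx n₁ n₂ → ℝ) :
    e₁ * correctorRate A D (i + 1) u v ≤
      -(3 / 4) * (e₁ * (((Bmat D * A ^ (i + 1)) *ᵥ v) ⬝ᵥ ((Bmat D * A ^ (i + 1)) *ᵥ v)))
      + δ * (e₀ * (((Bmat D * A ^ i) *ᵥ v) ⬝ᵥ ((Bmat D * A ^ i) *ᵥ v)))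
      + δ / 2 * (e₂ * (((Bmat D * A ^ (i + 2)) *ᵥ v) ⬝ᵥ ((Bmat D * A ^ (i + 2)) *ᵥ v)))
      + 3 / 2 * δ * M * sndSq u := by
  rw [correctorRate_succ]
  have hs₀ : 0 ≤ δ * e₀ := mul_nonneg hδ he₀
  have hs₂ : 0 ≤ δ * e₂ := mul_nonneg hδ he₂
  have hMb : 0 ≤ M * sndSq u := mul_nonneg hM (sndSq_nonneg u)
  have w1 := mul_le_mul_of_nonneg_right he₁δ hMb
  have w2 := mul_le_mul_of_nonneg_right (mul_le_mul_of_nonneg_left he₂1 hδ) hMb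
  generalize (Bmat D * A ^ i * Bmat D) *ᵥ u = a at *
  generalize (Bmat D * A ^ (i + 1) * Bmat D) *ᵥ u = b at *
  generalize (Bmat D * A ^ i) *ᵥ v = p at *
  generalize (Bmat D * A ^ (i + 1)) *ᵥ v = q at *
  generalize (Bmat D * A ^ (i + 2)) *ᵥ v = r at *
  have y1 := mul_abs_dotProduct_le (e := e₁) (s := 2 * e₁) (r := e₁ / 2)
    (by linarith) (by linarith) (by ring) a q
  have y2 := mul_abs_dotProduct_le hs₀ hs₂ hsq p r
  have y3 := mul_abs_dotProduct_le hs₀ hs₂ hsq p b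
  have z1 := mul_le_mul_of_nonneg_left h₁ he₁
  have z2 := mul_le_mul_of_nonneg_left h₂ hs₂
  have a1 := mul_le_mul_of_nonneg_left (neg_abs_le (a ⬝ᵥ q)) he₁
  have a2 := mul_le_mul_of_nonneg_left (le_abs_self (p ⬝ᵥ r)) he₁
  have a3 := mul_le_mul_of_nonneg_left (le_abs_self (p ⬝ᵥ b)) he₁
  linarith

set_option maxHeartbeats 1000000 in
theorem exists_corrector_coefficients (hn : 1 ≤ n₁ + n₂)
    (A : Matrix (Idx n₁ n₂) (Idx n₁ n₂) ℝ) (D : Matrix (Fin n₂) (Fin n₂) ℝ)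
    {κ : ℝ} (hκ : 0 < κ) (hK : KalmanCondition A (Bmat D)) :
    ∃ γ : ℝ, 0 < γ ∧ ∃ ε : ℕ → ℝ, (∀ k, 0 < ε k) ∧
      (∀ u v : Idx n₁ n₂ → ℝ,
        |∑ k ∈ Finset.Ico 1 (n₁ + n₂), ε k *
          (((Bmat D * A ^ (k - 1)) *ᵥ u) ⬝ᵥ ((Bmat D * A ^ k) *ᵥ v))|
            ≤ 1 / 2 * (u ⬝ᵥ u + v ⬝ᵥ v)) ∧
      ∀ u v : Idx n₁ n₂ → ℝ,
        2 * γ * (v ⬝ᵥ v) + ∑ k ∈ Finset.Ico 1 (n₁ + n₂), ε k * correctorRate A D k u v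
          ≤ κ / 2 * (sndSq u + sndSq v) := by
  obtain ⟨m, hm⟩ : ∃ m, n₁ + n₂ = m + 1 := ⟨n₁ + n₂ - 1, by omega⟩
  obtain ⟨K, hK0, hKv⟩ := exists_dotProduct_self_le_sum
    (fun k : Fin (m + 1) => Bmat D * A ^ (k : ℕ)) fun y hy =>
      hK y fun k hk => hy ⟨k, hm ▸ hk⟩
  obtain ⟨M₁, hM₁, hM₁w⟩ := exists_uniform_mulVec_dotProduct_self_le (range (m + 2))
    fun k => Bmat D * A ^ k
  obtain ⟨M₂, hM₂, hM₂w⟩ := exists_uniform_mulVec_dotProduct_self_le (range (m + 2))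
    fun k => Bmat D * A ^ k * Bmat D
  set M : ℝ := M₁ + M₂ + M₁ * K with hMdef
  have hM : 0 ≤ M := by positivity
  have hMK : M₁ * K ≤ M := by rw [hMdef]; linarith
  have hMM₁ : M₁ ≤ M := by have := mul_nonneg hM₁ hK0; linarith
  have hMM₂ : M₂ ≤ M := by have := mul_nonneg hM₁ hK0; linarith
  have hBA : ∀ k < m + 2, ∀ w : Idx n₁ n₂ → ℝ,
      ((Bmat D * A ^ k) *ᵥ w) ⬝ᵥ ((Bmat D * A ^ k) *ᵥ w) ≤ M * (w ⬝ᵥ w) := fun k hk w =>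
    (hM₁w k (Finset.mem_range.2 hk) w).trans
      (mul_le_mul_of_nonneg_right hMM₁ (zero_le_dotProduct_self w))
  have hBAB : ∀ k < m + 2, ∀ u : Idx n₁ n₂ → ℝ,
      ((Bmat D * A ^ k * Bmat D) *ᵥ u) ⬝ᵥ ((Bmat D * A ^ k * Bmat D) *ᵥ u) ≤ M * sndSq u := by
    intro k hk u
    have := hM₂w k (Finset.mem_range.2 hk) (sndProj *ᵥ u)
    rw [sndProj_mulVec_dotProduct_self] at this
    simp only [Matrix.mulVec_mulVec, Matrix.mul_assoc, Bmat_mul_sndProj] at this ⊢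
    exact this.trans (mul_le_mul_of_nonneg_right hMM₂ (sndSq_nonneg u))
  have hB0 : ∀ v : Idx n₁ n₂ → ℝ,
      ((Bmat D * A ^ 0) *ᵥ v) ⬝ᵥ ((Bmat D * A ^ 0) *ᵥ v) ≤ M * sndSq v := by
    intro v
    have := hBA 0 (by omega) (sndProj *ᵥ v)
    rw [sndProj_mulVec_dotProduct_self] at this
    simpa only [pow_zero, Matrix.mul_one, Matrix.mulVec_mulVec, Bmat_mul_sndProj] using this
  obtain ⟨δ, hδ, hδ1, hδQ⟩ := exists_pos_le_one_mul_le (6 * (m + 1) * (1 + M) ^ 2)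
    (by positivity) (lt_min one_pos hκ)
  obtain ⟨hQ1, hQκ⟩ := le_min_iff.1 hδQ
  have hm0 : (0 : ℝ) ≤ m := m.cast_nonneg
  set R : ℝ := δ * (m + 1) * (1 + M) ^ 2 with hR
  have hRle : ∀ a : ℝ, a ≤ (m + 1) * (1 + M) ^ 2 → δ * a ≤ R := fun a ha => by
    rw [hR, mul_assoc]; exact mul_le_mul_of_nonneg_left ha hδ.le
  have hmM : 0 ≤ m * M := by positivity
  have hmM2 : 0 ≤ m * M ^ 2 := by positivity
  have hR1 : δ * (1 + M) ≤ R := hRle _ (by nlinarith)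
  have hR2 : δ * ((1 + M) * M) ≤ R := hRle _ (by nlinarith)
  have hR3 : δ * (m * M) ≤ R := hRle _ (by nlinarith)
  have hR6 : 6 * R ≤ 1 := by rw [hR]; linarith
  have hRκ : 6 * R ≤ κ := by rw [hR]; linarith
  set ε := concaveWeight m δ with hε
  have hεpos : ∀ k, 0 < ε k := concaveWeight_pos hδ
  obtain ⟨γ, hγ, -, hγQ⟩ := exists_pos_le_one_mul_le (K * (1 + M))
    (by positivity) (lt_min (hεpos (m + 1)) hκ |> half_pos |> half_pos |> half_pos)
  have hγK : 0 ≤ γ * K := by positivity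
  have hγKM : 0 ≤ γ * K * M := by positivity
  have hγ1 : 2 * γ * K ≤ ε (m + 1) / 2 := by
    have := min_le_left (ε (m + 1)) κ
    have := hεpos (m + 1)
    nlinarith
  have hγ2 : 2 * γ * K * M ≤ κ / 4 := by
    have := min_le_right (ε (m + 1)) κ
    nlinarith
  refine ⟨γ, hγ, ε, hεpos, fun u v => ?_, fun u v => ?_⟩
  · rw [hm]
    have hu := zero_le_dotProduct_self u
    have hv := zero_le_dotProduct_self v
    calc _ ≤ ∑ k ∈ Finset.Ico 1 (m + 1), δ * M / 2 * (u ⬝ᵥ u + v ⬝ᵥ v) := by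
          refine (Finset.abs_sum_le_sum_abs _ _).trans (Finset.sum_le_sum fun k hk => ?_)
          obtain ⟨hk1, hk2⟩ := Finset.mem_Ico.1 hk
          rw [abs_mul, abs_of_pos (hεpos k)]
          refine (mul_abs_dotProduct_le (hεpos k).le (hεpos k).le
            (sq _) _ _).trans ?_
          have e1 := hBA (k - 1) (by omega) u
          have e2 := hBA k (by omega) v
          have e3 : ε k ≤ δ := concaveWeight_le hδ hδ1 hk1 hk2.le
          have e4 := mul_le_mul_of_nonneg_left (add_le_add e1 e2) (hεpos k).le
          have e5 := mul_le_mul_of_nonneg_right e3 (mul_nonneg hM (add_nonneg hu hv))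
          nlinarith
      _ = δ * (m * M) / 2 * (u ⬝ᵥ u + v ⬝ᵥ v) := by
          simp; ring
      _ ≤ _ := by
          refine mul_le_mul_of_nonneg_right ?_ (add_nonneg hu hv)
          linarith
  · set x : ℕ → ℝ := fun k => ((Bmat D * A ^ k) *ᵥ v) ⬝ᵥ ((Bmat D * A ^ k) *ᵥ v) with hx
    have hx0 : ∀ k, 0 ≤ x k := fun k => zero_le_dotProduct_self _
    have hb := sndSq_nonneg u
    have hbv := sndSq_nonneg v
    have hsum := sum_range_le_of_neighbour_bound m (fun i => ε i * x i)
      (fun i => ε (i + 1) * correctorRate A D (i + 1) u v)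
      (fun i => mul_nonneg (hεpos i).le (hx0 i)) hδ.le (c := 3 / 2 * δ * M * sndSq u) (by
        intro i hi
        exact mul_correctorRate_succ_le A D hδ.le (hεpos i).le (hεpos (i + 1)).le
          (hεpos (i + 2)).le (concaveWeight_sq δ hi)
          (concaveWeight_le hδ hδ1 (by omega) (by omega)) (concaveWeight_le_one hδ hδ1 _) hM
          (hBAB i (by omega) u) (hBAB (i + 1) (by omega) u) v)
    rw [hm, Finset.sum_Ico_eq_sum_range]
    simp only [Nat.add_sub_cancel, add_comm 1]
    set S := ∑ i ∈ range m, ε (i + 1) * x (i + 1) with hS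
    have hS0 : 0 ≤ S := Finset.sum_nonneg fun i _ => mul_nonneg (hεpos _).le (hx0 _)
    have hV := hKv v
    rw [Fin.sum_univ_eq_sum_range x (m + 1), Finset.sum_range_succ'] at hV
    set X := ∑ i ∈ range m, x (i + 1) with hX
    change v ⬝ᵥ v ≤ K * (X + x 0) at hV
    have hXS : ε (m + 1) * X ≤ S := by
      rw [hX, hS, Finset.mul_sum]
      refine Finset.sum_le_sum fun i hi => mul_le_mul_of_nonneg_right ?_ (hx0 _)
      have := Finset.mem_range.1 hi
      exact concaveWeight_last_le hδ hδ1 (by omega)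
    have hX0 : 0 ≤ X := Finset.sum_nonneg fun i _ => hx0 _
    have hε0 : ε 0 = 1 := concaveWeight_zero m δ
    have hlast : ε (m + 1) * x (m + 1) ≤ M * (x 0 + S) := by
      have h1 : x (m + 1) ≤ M * (X + x 0) := by
        calc x (m + 1) ≤ M₁ * (v ⬝ᵥ v) := hM₁w (m + 1) (by simp) v
          _ ≤ M₁ * (K * (X + x 0)) := mul_le_mul_of_nonneg_left hV hM₁
          _ = M₁ * K * (X + x 0) := by ring
          _ ≤ _ := mul_le_mul_of_nonneg_right hMK (add_nonneg hX0 (hx0 0))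
      have h2 : ε (m + 1) * x 0 ≤ x 0 :=
        mul_le_of_le_one_left (hx0 0) (concaveWeight_le_one hδ hδ1 _)
      calc ε (m + 1) * x (m + 1) ≤ ε (m + 1) * (M * (X + x 0)) :=
            mul_le_mul_of_nonneg_left h1 (hεpos _).le
        _ = M * (ε (m + 1) * x 0 + ε (m + 1) * X) := by ring
        _ ≤ _ := mul_le_mul_of_nonneg_left (add_le_add h2 hXS) hM
    have hx0v : x 0 ≤ M * sndSq v := hB0 v
    have f1 : 2 * γ * (v ⬝ᵥ v) ≤ S / 2 + κ / 4 * sndSq v := by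
      calc 2 * γ * (v ⬝ᵥ v) ≤ 2 * γ * (K * (X + x 0)) :=
            mul_le_mul_of_nonneg_left hV (by positivity)
        _ = 2 * γ * K * X + 2 * γ * K * x 0 := by ring
        _ ≤ ε (m + 1) / 2 * X + 2 * γ * K * (M * sndSq v) := by gcongr
        _ = ε (m + 1) * X / 2 + 2 * γ * K * M * sndSq v := by ring
        _ ≤ _ := by gcongr
    have f2 : 3 / 2 * δ * (x 0 + S + ε (m + 1) * x (m + 1))
        ≤ S / 4 + κ / 4 * sndSq v := by
      calc _ ≤ 3 / 2 * δ * (x 0 + S + M * (x 0 + S)) := by gcongr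
        _ = 3 / 2 * (δ * (1 + M)) * S + 3 / 2 * (δ * (1 + M)) * x 0 := by ring
        _ ≤ 3 / 2 * (δ * (1 + M)) * S + 3 / 2 * (δ * (1 + M)) * (M * sndSq v) := by gcongr
        _ = 3 / 2 * (δ * (1 + M)) * S + 3 / 2 * (δ * ((1 + M) * M)) * sndSq v := by ring
        _ ≤ 1 / 4 * S + κ / 4 * sndSq v := by gcongr <;> linarith
        _ = _ := by ring
    have f3 : m * (3 / 2 * δ * M * sndSq u) ≤ κ / 2 * sndSq u := by
      calc _ = 3 / 2 * (δ * (m * M)) * sndSq u := by ring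
        _ ≤ _ := by gcongr; linarith
    simp only [hε0, one_mul] at hsum
    linarith

end Coefficients

section Decay

variable {ι ι' : Type*} [Fintype ι] [Fintype ι'] {S : Set ℝ}

/-- A family of continuous functions decaying quadratically, uniformly in the parameter. -/
structure UniformDecay (S : Set ℝ) (f : ℝ → ℝ → ι → ℝ) : Prop where
  continuous : ∀ s ∈ S, Continuous (f s)
  bound : ∃ C : ℝ, ∀ s ∈ S, ∀ x, (1 + x ^ 2) * ‖f s x‖ ≤ C

namespace UniformDecay

variable {f g f' g' : ℝ → ℝ → ι → ℝ}

lemma mono (hf : UniformDecay S f) {S' : Set ℝ} (h : S' ⊆ S) : UniformDecay S' f :=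
  ⟨fun s hs => hf.continuous s (h hs), hf.bound.imp fun _ hC s hs => hC s (h hs)⟩

lemma add (hf : UniformDecay S f) (hg : UniformDecay S g) :
    UniformDecay S fun s x => f s x + g s x := by
  obtain ⟨C, hC⟩ := hf.bound
  obtain ⟨C', hC'⟩ := hg.bound
  refine ⟨fun s hs => (hf.continuous s hs).add (hg.continuous s hs), C + C', fun s hs x => ?_⟩
  have : (1 + x ^ 2) * ‖f s x + g s x‖ ≤ (1 + x ^ 2) * (‖f s x‖ + ‖g s x‖) := by
    gcongr
    exact norm_add_le _ _
  linarith [hC s hs x, hC' s hs x]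

lemma neg (hf : UniformDecay S f) : UniformDecay S fun s x => -f s x :=
  ⟨fun s hs => (hf.continuous s hs).neg, by simpa using hf.bound⟩

lemma mulVec (hf : UniformDecay S f) (P : Matrix ι' ι ℝ) :
    UniformDecay S fun s x => P *ᵥ f s x := by
  obtain ⟨C, hC⟩ := hf.bound
  let L := LinearMap.toContinuousLinearMap P.mulVecLin
  refine ⟨fun s hs => L.continuous.comp (hf.continuous s hs), ‖L‖ * C, fun s hs x => ?_⟩
  calc (1 + x ^ 2) * ‖P *ᵥ f s x‖ ≤ (1 + x ^ 2) * (‖L‖ * ‖f s x‖) := by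
        gcongr
        exact L.le_opNorm (f s x)
    _ = ‖L‖ * ((1 + x ^ 2) * ‖f s x‖) := by ring
    _ ≤ ‖L‖ * C := by gcongr; exact hC s hs x

lemma exists_abs_dotProduct_le (hf : UniformDecay S f) (hg : UniformDecay S g) :
    ∃ C : ℝ, ∀ s ∈ S, ∀ x, |f s x ⬝ᵥ g s x| ≤ C * (1 + x ^ 2)⁻¹ := by
  obtain ⟨C, hC⟩ := hf.bound
  obtain ⟨C', hC'⟩ := hg.bound
  refine ⟨Fintype.card ι * (C * C'), fun s hs x => ?_⟩
  have hx : 0 < 1 + x ^ 2 := by positivity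
  have hg1 : ‖g s x‖ ≤ C' :=
    (le_mul_of_one_le_left (norm_nonneg _) (by nlinarith)).trans (hC' s hs x)
  have hf1 : ‖f s x‖ ≤ C * (1 + x ^ 2)⁻¹ := by
    rw [← div_eq_mul_inv, le_div_iff₀ hx, mul_comm]
    exact hC s hs x
  calc |f s x ⬝ᵥ g s x| ≤ ∑ i, |f s x i * g s x i| := Finset.abs_sum_le_sum_abs _ _
    _ ≤ ∑ _i : ι, ‖f s x‖ * ‖g s x‖ := Finset.sum_le_sum fun i _ => by
        rw [abs_mul]
        exact mul_le_mul (norm_le_pi_norm (f s x) i) (norm_le_pi_norm (g s x) i)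
          (abs_nonneg _) (norm_nonneg _)
    _ = Fintype.card ι * (‖f s x‖ * ‖g s x‖) := by simp
    _ ≤ Fintype.card ι * (C * (1 + x ^ 2)⁻¹ * C') := by
        have := (norm_nonneg (f s x)).trans hf1
        gcongr
    _ = _ := by ring

lemma continuous_dotProduct (hf : UniformDecay S f) (hg : UniformDecay S g) {s : ℝ}
    (hs : s ∈ S) : Continuous fun x => f s x ⬝ᵥ g s x :=
  (hf.continuous s hs).dotProduct (hg.continuous s hs)

lemma integrable_dotProduct (hf : UniformDecay S f) (hg : UniformDecay S g) {s : ℝ}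
    (hs : s ∈ S) : Integrable fun x => f s x ⬝ᵥ g s x := by
  obtain ⟨C, hC⟩ := hf.exists_abs_dotProduct_le hg
  exact (integrable_inv_one_add_sq.const_mul C).mono'
    (hf.continuous_dotProduct hg hs).aestronglyMeasurable (Filter.Eventually.of_forall (hC s hs))

end UniformDecay

lemma HasDerivAt.dotProduct_real {f g : ℝ → ι → ℝ} {f' g' : ι → ℝ} {x : ℝ}
    (hf : HasDerivAt f f' x) (hg : HasDerivAt g g' x) :
    HasDerivAt (fun y => f y ⬝ᵥ g y) (f' ⬝ᵥ g x + f x ⬝ᵥ g') x := by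
  rw [hasDerivAt_pi] at hf hg
  simp only [dotProduct, ← Finset.sum_add_distrib]
  exact HasDerivAt.fun_sum fun i _ => (hf i).mul (hg i)

lemma HasDerivAt.mulVec_real {f : ℝ → ι → ℝ} {f' : ι → ℝ} {x : ℝ}
    (hf : HasDerivAt f f' x) (P : Matrix ι' ι ℝ) :
    HasDerivAt (fun y => P *ᵥ f y) (P *ᵥ f') x :=
  (LinearMap.toContinuousLinearMap P.mulVecLin).hasFDerivAt.comp_hasDerivAt x hf

variable {f g f' g' : ℝ → ℝ → ι → ℝ}

lemma UniformDecay.integral_deriv_dotProduct (hf : UniformDecay S f) (hg : UniformDecay S g)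
    (hf' : UniformDecay S f') (hg' : UniformDecay S g') {s : ℝ} (hs : s ∈ S)
    (hfd : ∀ x, HasDerivAt (f s) (f' s x) x) (hgd : ∀ x, HasDerivAt (g s) (g' s x) x) :
    ∫ x, f' s x ⬝ᵥ g s x = -∫ x, f s x ⬝ᵥ g' s x := by
  have h1 := hf'.integrable_dotProduct hg hs
  have h2 := hf.integrable_dotProduct hg' hs
  have h := integral_eq_zero_of_hasDerivAt_of_integrable
    (fun x => (hfd x).dotProduct_real (hgd x)) (h1.add h2) (hf.integrable_dotProduct hg hs)
  rw [integral_add h1 h2] at h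
  linarith

lemma UniformDecay.hasDerivAt_integral_dotProduct (hS : IsOpen S) (hf : UniformDecay S f)
    (hg : UniformDecay S g) (hf' : UniformDecay S f') (hg' : UniformDecay S g') {t : ℝ}
    (ht : t ∈ S) (hfd : ∀ s ∈ S, ∀ x, HasDerivAt (fun r => f r x) (f' s x) s)
    (hgd : ∀ s ∈ S, ∀ x, HasDerivAt (fun r => g r x) (g' s x) s) :
    HasDerivAt (fun s => ∫ x, f s x ⬝ᵥ g s x)
      ((∫ x, f' t x ⬝ᵥ g t x) + ∫ x, f t x ⬝ᵥ g' t x) t := by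
  obtain ⟨C, hC⟩ := hf'.exists_abs_dotProduct_le hg
  obtain ⟨C', hC'⟩ := hf.exists_abs_dotProduct_le hg'
  rw [← integral_add (hf'.integrable_dotProduct hg ht) (hf.integrable_dotProduct hg' ht)]
  refine (hasDerivAt_integral_of_dominated_loc_of_deriv_le (s := S)
    (F := fun s x => f s x ⬝ᵥ g s x)
    (F' := fun s x => f' s x ⬝ᵥ g s x + f s x ⬝ᵥ g' s x)
    (bound := fun x => (C + C') * (1 + x ^ 2)⁻¹) (hS.mem_nhds ht) ?_
    (hf.integrable_dotProduct hg ht) ?_ ?_ (integrable_inv_one_add_sq.const_mul _) ?_).2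
  · filter_upwards [hS.mem_nhds ht] with s hs
    exact (hf.continuous_dotProduct hg hs).aestronglyMeasurable
  · exact ((hf'.continuous_dotProduct hg ht).add
      (hf.continuous_dotProduct hg' ht)).aestronglyMeasurable
  · refine Filter.Eventually.of_forall fun x s hs => (norm_add_le _ _).trans ?_
    rw [add_mul]
    exact add_le_add (hC s hs x) (hC' s hs x)
  · exact Filter.Eventually.of_forall fun x s hs => (hfd s hs x).dotProduct_real (hgd s hs x)

lemma UniformDecay.integral_dotProduct_symm_deriv (hf : UniformDecay S f)
    (hf' : UniformDecay S f') {s : ℝ} (hs : s ∈ S) (hfd : ∀ x, HasDerivAt (f s) (f' s x) x)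
    {A : Matrix ι ι ℝ} (hA : A.IsSymm) : ∫ x, f s x ⬝ᵥ (A *ᵥ f' s x) = 0 := by
  have h := (hf.mulVec A).integral_deriv_dotProduct hf (hf'.mulVec A) hf' hs
    (fun x => (hfd x).mulVec_real A) hfd
  have e : ∀ v w : ι → ℝ, (A *ᵥ v) ⬝ᵥ w = v ⬝ᵥ (A *ᵥ w) := fun v w => by
    rw [dotProduct_mulVec, ← mulVec_transpose, hA.eq]
  simp only [e] at h
  have e' : ∀ x, f' s x ⬝ᵥ (A *ᵥ f s x) = f s x ⬝ᵥ (A *ᵥ f' s x) := fun x => by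
    rw [dotProduct_comm, e]
  simp only [e'] at h
  linarith

lemma sqL2_eq_integral_dotProduct (h : ℝ → ι → ℝ) : sqL2 h = ∫ x, h x ⬝ᵥ h x := by
  simp only [sqL2, dotProduct, sq]

lemma sqL2_nonneg (h : ℝ → ι → ℝ) : 0 ≤ sqL2 h :=
  integral_nonneg fun _ => Finset.sum_nonneg fun _ _ => sq_nonneg _

end Decay

namespace IsClassicalSolution

variable {n₁ n₂ : ℕ} {A : Matrix (Idx n₁ n₂) (Idx n₁ n₂) ℝ} {D : Matrix (Fin n₂) (Fin n₂) ℝ}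
  {U : ℝ → ℝ → Idx n₁ n₂ → ℝ}

lemma contDiff_space (hU : IsClassicalSolution A D U) (t : ℝ) : ContDiff ℝ (⊤ : ℕ∞) (U t) :=
  hU.smooth.comp (contDiff_const.prodMk contDiff_id)

lemma contDiff_pdx (hU : IsClassicalSolution A D U) (t : ℝ) :
    ContDiff ℝ (⊤ : ℕ∞) (pdx U t) :=
  (contDiff_infty_iff_deriv.1 (hU.contDiff_space t)).2

lemma hasDerivAt_space (hU : IsClassicalSolution A D U) (t x : ℝ) :
    HasDerivAt (U t) (pdx U t x) x :=
  ((hU.contDiff_space t).differentiable (by simp) x).hasDerivAt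

lemma hasDerivAt_pdx_space (hU : IsClassicalSolution A D U) (t x : ℝ) :
    HasDerivAt (pdx U t) (pdx (pdx U) t x) x :=
  ((hU.contDiff_pdx t).differentiable (by simp) x).hasDerivAt

lemma hasDerivAt_time (hU : IsClassicalSolution A D U) {t : ℝ} (ht : 0 ≤ t) (x : ℝ) :
    HasDerivAt (fun s => U s x) (-(A *ᵥ pdx U t x + Bmat D *ᵥ U t x)) t := by
  have h : DifferentiableAt ℝ (fun s => U s x) t :=
    ((hU.smooth.comp (contDiff_id.prodMk contDiff_const)).differentiable (by simp) t)
  have e := hU.eqn t x ht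
  rw [add_assoc] at e
  rw [← eq_neg_of_add_eq_zero_left e]
  exact h.hasDerivAt

lemma hasDerivAt_pdx_time (hU : IsClassicalSolution A D U) {t : ℝ} (ht : 0 ≤ t) (x : ℝ) :
    HasDerivAt (fun s => pdx U s x) (-(A *ᵥ pdx (pdx U) t x + Bmat D *ᵥ pdx U t x)) t := by
  set F : ℝ × ℝ → Idx n₁ n₂ → ℝ := fun p => U p.1 p.2 with hF
  have hFd : Differentiable ℝ F := hU.smooth.differentiable (by simp)
  have hΦ : Differentiable ℝ (fderiv ℝ F) :=
    (hU.smooth.fderiv_right (m := (⊤ : ℕ∞)) (by simp)).differentiable (by simp)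
  have hl : ∀ s y : ℝ, HasDerivAt (fun r : ℝ => (r, y)) ((1 : ℝ), (0 : ℝ)) s := fun s y =>
    (hasDerivAt_id s).prodMk (hasDerivAt_const s y)
  have hr : ∀ s y : ℝ, HasDerivAt (fun r : ℝ => (s, r)) ((0 : ℝ), (1 : ℝ)) y := fun s y =>
    (hasDerivAt_const y s).prodMk (hasDerivAt_id y)
  have hx : ∀ s y, pdx U s y = fderiv ℝ F (s, y) (0, 1) := fun s y =>
    ((hFd (s, y)).hasFDerivAt.comp_hasDerivAt y (hr s y)).deriv
  have ht' : ∀ y, -(A *ᵥ pdx U t y + Bmat D *ᵥ U t y) = fderiv ℝ F (t, y) (1, 0) := fun y => by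
    have h : HasDerivAt (fun s => U s y) (fderiv ℝ F (t, y) (1, 0)) t :=
      HasFDerivAt.comp_hasDerivAt (l := F) t (hFd (t, y)).hasFDerivAt (hl t y)
    exact (hU.hasDerivAt_time ht y).unique h
  have hsymm : IsSymmSndFDerivAt ℝ F (t, x) :=
    (contDiff_infty.1 hU.smooth 2).contDiffAt.isSymmSndFDerivAt (by simp)
  have h1 : HasDerivAt (fun s => fderiv ℝ F (s, x) (0, 1))
      (fderiv ℝ (fderiv ℝ F) (t, x) (1, 0) (0, 1)) t :=
    (ContinuousLinearMap.apply ℝ (Idx n₁ n₂ → ℝ) ((0 : ℝ), (1 : ℝ))).hasFDerivAt.comp_hasDerivAt t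
      ((hΦ (t, x)).hasFDerivAt.comp_hasDerivAt t (hl t x))
  have h2 : HasDerivAt (fun y => fderiv ℝ F (t, y) (1, 0))
      (fderiv ℝ (fderiv ℝ F) (t, x) (0, 1) (1, 0)) x :=
    (ContinuousLinearMap.apply ℝ (Idx n₁ n₂ → ℝ) ((1 : ℝ), (0 : ℝ))).hasFDerivAt.comp_hasDerivAt x
      ((hΦ (t, x)).hasFDerivAt.comp_hasDerivAt x (hr t x))
  have h3 : HasDerivAt (fun y => -(A *ᵥ pdx U t y + Bmat D *ᵥ U t y))
      (-(A *ᵥ pdx (pdx U) t x + Bmat D *ᵥ pdx U t x)) x :=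
    (((hU.hasDerivAt_pdx_space t x).mulVec_real A).add
      ((hU.hasDerivAt_space t x).mulVec_real (Bmat D))).neg
  simp only [ht'] at h3
  have h4 : HasDerivAt (fun s => pdx U s x) (fderiv ℝ (fderiv ℝ F) (t, x) (1, 0) (0, 1)) t := by
    simpa only [hx] using h1
  rwa [h3.unique h2, hsymm.eq]

lemma uniformDecay_iteratedDeriv (hU : IsClassicalSolution A D U) (m : ℕ) (T : ℝ) :
    UniformDecay (Set.Icc 0 T) fun t => iteratedDeriv m (U t) := by
  obtain ⟨C, hC⟩ := hU.decay 0 m T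
  obtain ⟨C', hC'⟩ := hU.decay 2 m T
  refine ⟨fun t _ => (hU.contDiff_space t).continuous_iteratedDeriv m (by exact_mod_cast le_top),
    C + C', fun t ht x => ?_⟩
  have h1 := hC t ht x
  have h2 := hC' t ht x
  rw [sq_abs] at h2
  rw [pow_zero, one_mul] at h1
  rw [add_mul, one_mul]
  exact add_le_add h1 h2

lemma uniformDecay (hU : IsClassicalSolution A D U) (T : ℝ) :
    UniformDecay (Set.Icc 0 T) U := by
  simpa only [iteratedDeriv_zero] using hU.uniformDecay_iteratedDeriv 0 T

lemma uniformDecay_pdx (hU : IsClassicalSolution A D U) (T : ℝ) :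
    UniformDecay (Set.Icc 0 T) (pdx U) := by
  have h := hU.uniformDecay_iteratedDeriv 1 T
  simp only [iteratedDeriv_one] at h
  exact h

lemma uniformDecay_pdx_pdx (hU : IsClassicalSolution A D U) (T : ℝ) :
    UniformDecay (Set.Icc 0 T) (pdx (pdx U)) := by
  have h := hU.uniformDecay_iteratedDeriv 2 T
  simp only [iteratedDeriv_succ, iteratedDeriv_zero] at h
  exact h

end IsClassicalSolution

namespace IsClassicalSolution

variable {n₁ n₂ : ℕ} {A : Matrix (Idx n₁ n₂) (Idx n₁ n₂) ℝ} {D : Matrix (Fin n₂) (Fin n₂) ℝ}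
  {U : ℝ → ℝ → Idx n₁ n₂ → ℝ}

lemma hasDerivAt_sqL2 (hA : A.IsSymm) {Z Z' : ℝ → ℝ → Idx n₁ n₂ → ℝ} {S : Set ℝ}
    (hS : IsOpen S) (hZ : UniformDecay S Z) (hZ' : UniformDecay S Z')
    (hx : ∀ s ∈ S, ∀ x, HasDerivAt (Z s) (Z' s x) x)
    (ht : ∀ s ∈ S, ∀ x, HasDerivAt (fun r => Z r x) (-(A *ᵥ Z' s x + Bmat D *ᵥ Z s x)) s)
    {t : ℝ} (hts : t ∈ S) :
    HasDerivAt (fun s => sqL2 (Z s)) (-2 * ∫ x, Z t x ⬝ᵥ (Bmat D *ᵥ Z t x)) t := by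
  have hdt := ((hZ'.mulVec A).add (hZ.mulVec (Bmat D))).neg
  have h := hZ.hasDerivAt_integral_dotProduct hS hZ hdt hdt hts ht ht
  simp only [← sqL2_eq_integral_dotProduct] at h
  refine h.congr_deriv ?_
  have e : ∀ x, Z t x ⬝ᵥ -(A *ᵥ Z' t x + Bmat D *ᵥ Z t x)
      = -(Z t x ⬝ᵥ (A *ᵥ Z' t x) + Z t x ⬝ᵥ (Bmat D *ᵥ Z t x)) := fun x => by
    rw [dotProduct_neg, dotProduct_add]
  have e' : ∀ x, -(A *ᵥ Z' t x + Bmat D *ᵥ Z t x) ⬝ᵥ Z t x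
      = -(Z t x ⬝ᵥ (A *ᵥ Z' t x) + Z t x ⬝ᵥ (Bmat D *ᵥ Z t x)) := fun x => by
    rw [dotProduct_comm, e]
  simp only [e, e']
  rw [integral_neg, integral_add (hZ.integrable_dotProduct (hZ'.mulVec A) hts)
    (hZ.integrable_dotProduct (hZ.mulVec _) hts),
    hZ.integral_dotProduct_symm_deriv hZ' hts (hx t hts) hA]
  ring

lemma integrable_correctorRate (hU : IsClassicalSolution A D U) (k : ℕ) {t : ℝ} (ht : 0 ≤ t) :
    Integrable fun x => correctorRate A D k (U t x) (pdx U t x) := by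
  have hts : t ∈ Set.Icc 0 t := ⟨ht, le_rfl⟩
  have h0 := hU.uniformDecay t
  have h1 := hU.uniformDecay_pdx t
  have h := (h1.mulVec A).add (h0.mulVec (Bmat D))
  exact ((h1.mulVec _).integrable_dotProduct (h.mulVec _) hts).sub
    ((h.mulVec _).integrable_dotProduct (h1.mulVec _) hts)

lemma hasDerivAt_corrector (hU : IsClassicalSolution A D U) (ε : ℕ → ℝ) {t : ℝ} (ht : 0 < t) :
    HasDerivAt (corrector A D ε U)
      (∑ k ∈ Finset.Ico 1 (n₁ + n₂), ε k * ∫ x, correctorRate A D k (U t x) (pdx U t x)) t := by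
  have hsub : Set.Ioo 0 (t + 1) ⊆ Set.Icc 0 (t + 1) := Set.Ioo_subset_Icc_self
  have hts : t ∈ Set.Ioo 0 (t + 1) := ⟨ht, by linarith⟩
  have h0 := (hU.uniformDecay (t + 1)).mono hsub
  have h1 := (hU.uniformDecay_pdx (t + 1)).mono hsub
  have h2 := (hU.uniformDecay_pdx_pdx (t + 1)).mono hsub
  have hd0 := (h1.mulVec A).add (h0.mulVec (Bmat D))
  have hd1 := (h2.mulVec A).add (h1.mulVec (Bmat D))
  refine HasDerivAt.fun_sum fun k _ => HasDerivAt.const_mul (ε k) ?_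
  have h := (h0.mulVec (Bmat D * A ^ (k - 1))).hasDerivAt_integral_dotProduct isOpen_Ioo
    (h1.mulVec (Bmat D * A ^ k)) (hd0.neg.mulVec _) (hd1.neg.mulVec _) hts
    (fun s hs x => (hU.hasDerivAt_time hs.1.le x).mulVec_real _)
    (fun s hs x => (hU.hasDerivAt_pdx_time hs.1.le x).mulVec_real _)
  have hibp := (h0.mulVec (Bmat D * A ^ (k - 1))).integral_deriv_dotProduct
    (hd0.mulVec (Bmat D * A ^ k)) (h1.mulVec _) (hd1.mulVec _) hts
    (fun x => (hU.hasDerivAt_space t x).mulVec_real _)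
    (fun x => (((hU.hasDerivAt_pdx_space t x).mulVec_real A).add
      ((hU.hasDerivAt_space t x).mulVec_real (Bmat D))).mulVec_real _)
  refine h.congr_deriv ?_
  simp only [Matrix.mulVec_neg, dotProduct_neg, neg_dotProduct, integral_neg]
  rw [← hibp]
  simp only [correctorRate]
  rw [integral_sub ((h1.mulVec _).integrable_dotProduct (hd0.mulVec _) hts)
    ((hd0.mulVec _).integrable_dotProduct (h1.mulVec _) hts)]
  ring

end IsClassicalSolution

lemma UniformDecay.integrable_sndSq {n₁ n₂ : ℕ} {S : Set ℝ} {f : ℝ → ℝ → Idx n₁ n₂ → ℝ}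
    (hf : UniformDecay S f) {s : ℝ} (hs : s ∈ S) : Integrable fun x => sndSq (f s x) := by
  simpa only [sndProj_mulVec_dotProduct_self] using
    (hf.mulVec sndProj).integrable_dotProduct (hf.mulVec sndProj) hs

lemma UniformDecay.mul_integral_sndSq_le {n₁ n₂ : ℕ} {D : Matrix (Fin n₂) (Fin n₂) ℝ} {κ : ℝ}
    (hdiss : ∀ X : Fin n₂ → ℝ, κ * ∑ j, (X j) ^ 2 ≤ ∑ j, D.mulVec X j * X j)
    {S : Set ℝ} {f : ℝ → ℝ → Idx n₁ n₂ → ℝ} (hf : UniformDecay S f) {s : ℝ} (hs : s ∈ S) :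
    κ * ∫ x, sndSq (f s x) ≤ ∫ x, f s x ⬝ᵥ (Bmat D *ᵥ f s x) := by
  rw [← integral_const_mul]
  refine integral_mono ((hf.integrable_sndSq hs).const_mul κ)
    (hf.integrable_dotProduct (hf.mulVec _) hs) fun x => ?_
  beta_reduce
  rw [dotProduct_Bmat_mulVec]
  exact hdiss _

namespace IsClassicalSolution

variable {n₁ n₂ : ℕ} {A : Matrix (Idx n₁ n₂) (Idx n₁ n₂) ℝ} {D : Matrix (Fin n₂) (Fin n₂) ℝ}
  {U : ℝ → ℝ → Idx n₁ n₂ → ℝ}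

lemma abs_corrector_le (hU : IsClassicalSolution A D U) {ε : ℕ → ℝ}
    (h : ∀ u v : Idx n₁ n₂ → ℝ, |∑ k ∈ Finset.Ico 1 (n₁ + n₂), ε k *
      (((Bmat D * A ^ (k - 1)) *ᵥ u) ⬝ᵥ ((Bmat D * A ^ k) *ᵥ v))|
        ≤ 1 / 2 * (u ⬝ᵥ u + v ⬝ᵥ v)) {t : ℝ} (ht : 0 ≤ t) :
    |corrector A D ε U t| ≤ 1 / 2 * sqH1 (U t) := by
  have hts : t ∈ Set.Icc 0 t := ⟨ht, le_rfl⟩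
  have h0 := hU.uniformDecay t
  have h1 := hU.uniformDecay_pdx t
  have e : corrector A D ε U t = ∫ x, ∑ k ∈ Finset.Ico 1 (n₁ + n₂), ε k *
      (((Bmat D * A ^ (k - 1)) *ᵥ U t x) ⬝ᵥ ((Bmat D * A ^ k) *ᵥ pdx U t x)) := by
    rw [integral_finsetSum _ fun k _ =>
      ((h0.mulVec _).integrable_dotProduct (h1.mulVec _) hts).const_mul (ε k)]
    simp only [integral_const_mul]
    rfl
  have e' : sqH1 (U t) = ∫ x, (U t x ⬝ᵥ U t x + pdx U t x ⬝ᵥ pdx U t x) := by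
    rw [integral_add (h0.integrable_dotProduct h0 hts) (h1.integrable_dotProduct h1 hts),
      ← sqL2_eq_integral_dotProduct, ← sqL2_eq_integral_dotProduct]
    rfl
  rw [e, e', ← integral_const_mul, ← Real.norm_eq_abs]
  exact norm_integral_le_of_norm_le
    (((h0.integrable_dotProduct h0 hts).add (h1.integrable_dotProduct h1 hts)).const_mul _)
    (Filter.Eventually.of_forall fun x => h _ _)

lemma integral_correctorRate_le (hU : IsClassicalSolution A D U) {ε : ℕ → ℝ} {γ κ : ℝ}
    (h : ∀ u v : Idx n₁ n₂ → ℝ,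
      2 * γ * (v ⬝ᵥ v) + ∑ k ∈ Finset.Ico 1 (n₁ + n₂), ε k * correctorRate A D k u v
        ≤ κ / 2 * (sndSq u + sndSq v)) {t : ℝ} (ht : 0 ≤ t) :
    2 * γ * sqL2 (pdx U t)
      + ∑ k ∈ Finset.Ico 1 (n₁ + n₂), ε k * ∫ x, correctorRate A D k (U t x) (pdx U t x)
      ≤ κ / 2 * ((∫ x, sndSq (U t x)) + ∫ x, sndSq (pdx U t x)) := by
  have hts : t ∈ Set.Icc 0 t := ⟨ht, le_rfl⟩
  have h0 := hU.uniformDecay t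
  have h1 := hU.uniformDecay_pdx t
  have i1 := (h1.integrable_dotProduct h1 hts).const_mul (2 * γ)
  have i2 := fun k => (hU.integrable_correctorRate k ht).const_mul (ε k)
  have i3 := integrable_finsetSum (Finset.Ico 1 (n₁ + n₂)) fun k _ => i2 k
  rw [sqL2_eq_integral_dotProduct]
  simp only [← integral_const_mul]
  rw [← integral_finsetSum _ fun k _ => i2 k, ← integral_add i1 i3,
    ← integral_add (h0.integrable_sndSq hts) (h1.integrable_sndSq hts), ← integral_const_mul]
  exact integral_mono (i1.add i3)
    (((h0.integrable_sndSq hts).add (h1.integrable_sndSq hts)).const_mul _) fun x => h _ _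

lemma hasDerivAt_lyapunov (hA : A.IsSymm) (hU : IsClassicalSolution A D U) (η : ℝ) (ε : ℕ → ℝ)
    {t : ℝ} (ht : 0 < t) :
    HasDerivAt (lyapunov A D η ε U)
      (-2 * (∫ x, U t x ⬝ᵥ (Bmat D *ᵥ U t x))
        + -2 * (∫ x, pdx U t x ⬝ᵥ (Bmat D *ᵥ pdx U t x))
        + (η * sqL2 (pdx U t) + η * t * (-2 * ∫ x, pdx U t x ⬝ᵥ (Bmat D *ᵥ pdx U t x)))
        + ∑ k ∈ Finset.Ico 1 (n₁ + n₂),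
            ε k * ∫ x, correctorRate A D k (U t x) (pdx U t x)) t := by
  have hsub : Set.Ioo 0 (t + 1) ⊆ Set.Icc 0 (t + 1) := Set.Ioo_subset_Icc_self
  have hts : t ∈ Set.Ioo 0 (t + 1) := ⟨ht, by linarith⟩
  have h0 := (hU.uniformDecay (t + 1)).mono hsub
  have h1 := (hU.uniformDecay_pdx (t + 1)).mono hsub
  have h2 := (hU.uniformDecay_pdx_pdx (t + 1)).mono hsub
  have d0 := hasDerivAt_sqL2 hA isOpen_Ioo h0 h1 (fun s _ x => hU.hasDerivAt_space s x)
    (fun s hs x => hU.hasDerivAt_time hs.1.le x) hts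
  have d1 := hasDerivAt_sqL2 hA isOpen_Ioo h1 h2 (fun s _ x => hU.hasDerivAt_pdx_space s x)
    (fun s hs x => hU.hasDerivAt_pdx_time hs.1.le x) hts
  have d2 := ((hasDerivAt_id t).const_mul η).mul d1
  rw [mul_one] at d2
  exact ((d0.add d1).add d2).add (hU.hasDerivAt_corrector ε ht)

end IsClassicalSolution

/-- Hypocoercive Lyapunov functional in physical space: under the
Kalman rank condition there are positive constants `η₀, ε₁,…,ε_{n−1}, c₀, c₁, c₂` such
that `𝓛(t)` is equivalent to `‖U(t)‖²_{H¹} + η₀ t‖∂ₓU(t)‖²_{L²}` and satisfies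
`(d/dt)𝓛(t) + (κ/2)‖U₂‖² + κ(½+η₀t)‖∂ₓU₂‖² + c₂‖∂ₓU‖² ≤ 0` for `t > 0`. -/
theorem hypocoercive_lyapunov
    {n₁ n₂ : ℕ} (hn₁ : 1 ≤ n₁) (hn₂ : 1 ≤ n₂)
    (A : Matrix (Idx n₁ n₂) (Idx n₁ n₂) ℝ) (hA : A.IsSymm)
    (D : Matrix (Fin n₂) (Fin n₂) ℝ) (hD : D.IsSymm) (hDpos : D.PosDef)
    (κ : ℝ) (hκ : 0 < κ)
    (hdiss : ∀ X : Fin n₂ → ℝ, κ * ∑ j, (X j) ^ 2 ≤ ∑ j, D.mulVec X j * X j)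
    (hK : KalmanCondition A (Bmat D)) :
    ∃ η₀ : ℝ, 0 < η₀ ∧ ∃ ε : ℕ → ℝ, (∀ k ∈ Finset.Ico 1 (n₁ + n₂), 0 < ε k) ∧
      ∃ c₀ c₁ c₂ : ℝ, 0 < c₀ ∧ 0 < c₁ ∧ 0 < c₂ ∧
        ∀ U : ℝ → ℝ → Idx n₁ n₂ → ℝ, IsClassicalSolution A D U →
          (∀ t : ℝ, 0 ≤ t →
            c₀ * (sqH1 (U t) + η₀ * t * sqL2 (fun x => pdx U t x)) ≤
                lyapunov A D η₀ ε U t ∧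
              lyapunov A D η₀ ε U t ≤
                c₁ * (sqH1 (U t) + η₀ * t * sqL2 (fun x => pdx U t x))) ∧
          ∀ t : ℝ, 0 < t → ∃ d : ℝ,
            HasDerivAt (lyapunov A D η₀ ε U) d t ∧
            d + (κ / 2) * sqL2 (U2part U t)
              + κ * (1 / 2 + η₀ * t) * sqL2 (fun x j => pdx U t x (Sum.inr j))
              + c₂ * sqL2 (fun x => pdx U t x) ≤ 0 := by
  obtain ⟨γ, hγ, ε, hε, hcor, hrate⟩ :=
    exists_corrector_coefficients (by omega) A D hκ hK
  refine ⟨γ, hγ, ε, fun k _ => hε k, 1 / 2, 3 / 2, γ, by norm_num, by norm_num, hγ,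
    fun U hU => ⟨fun t ht => ?_, fun t ht => ⟨_, hU.hasDerivAt_lyapunov hA γ ε ht, ?_⟩⟩⟩
  · have hc := abs_le.1 (hU.abs_corrector_le hcor ht)
    have hV : 0 ≤ γ * t * sqL2 (fun x => pdx U t x) :=
      mul_nonneg (mul_nonneg hγ.le ht) (sqL2_nonneg _)
    unfold lyapunov
    constructor <;> linarith
  · have hts : t ∈ Set.Icc 0 t := ⟨ht.le, le_rfl⟩
    have hr := hU.integral_correctorRate_le hrate ht.le
    have hd0 := (hU.uniformDecay t).mul_integral_sndSq_le hdiss hts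
    have hd1 := (hU.uniformDecay_pdx t).mul_integral_sndSq_le hdiss hts
    have hb0 : 0 ≤ κ * ∫ x, sndSq (U t x) :=
      mul_nonneg hκ.le (integral_nonneg fun x => sndSq_nonneg _)
    have hb1 : 0 ≤ κ * ∫ x, sndSq (pdx U t x) :=
      mul_nonneg hκ.le (integral_nonneg fun x => sndSq_nonneg _)
    have ht1 := mul_le_mul_of_nonneg_left hd1 (mul_nonneg hγ.le ht.le)
    have ht2 := mul_nonneg (mul_nonneg hγ.le ht.le) hb1
    change _ + κ / 2 * (∫ x, sndSq (U t x)) + κ * (1 / 2 + γ * t) * (∫ x, sndSq (pdx U t x))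
      + γ * sqL2 (pdx U t) ≤ 0
    linarith
end
end
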